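/- Let σ be a distortion function and p ∈ (1,∞) with conjugate exponent q. Then L_σ^p(P)^× = L*_{σ,q}(P); for every Z ∈ L_σ^p(P)^× the functional φ_Z(Y) := E(ZY) satisfies |Z|*_{σ,q} = ‖φ_Z‖* := sup{|E(ZY)| : ‖Y‖_{σ,p} ≤ 1}; and this supremum is attained: there exists Y ∈ L_σ^p(P) with ‖Y‖_{σ,p} = 1 such that φ_Z(Y) = ‖φ_Z‖*. -/

import Mathlib

open MeasureTheory
open scoped ENNReal NNReal

noncomputable section

variable {Ω : Type*} [MeasurableSpace Ω]

/-- A `[0,1]`-valued random variable uniformly distributed on `[0,1]`: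
`P(U ≤ u) = u` for all `u ∈ [0,1]`. -/
def IsUniformRV (P : Measure Ω) (U : Ω → ℝ) : Prop :=
  Measurable U ∧ (∀ ω, U ω ∈ Set.Icc (0 : ℝ) 1) ∧
    ∀ u ∈ Set.Icc (0 : ℝ) 1, P {ω | U ω ≤ u} = ENNReal.ofReal u

/-- A distortion function: nondecreasing, nonnegative, left-continuous on `[0,1)`
with `∫₀¹ σ(u) du = 1`. -/
structure IsDistortion (σ : ℝ → ℝ) : Prop where
  nonneg : ∀ u ∈ Set.Ico (0 : ℝ) 1, 0 ≤ σ u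
  mono : MonotoneOn σ (Set.Ico (0 : ℝ) 1)
  left_continuous : ∀ u ∈ Set.Ioo (0 : ℝ) 1,
    Filter.Tendsto σ (nhdsWithin u (Set.Iio u)) (nhds (σ u))
  integral_one : ∫ u in Set.Ioo (0 : ℝ) 1, σ u = 1

/-- `‖Y‖_{σ,p}^p := sup over uniform U of E[σ(U)·‖Y‖^p]`. -/
def sigmaPow (P : Measure Ω) (σ : ℝ → ℝ) (p : ℝ) {X : Type*} [NormedAddCommGroup X]
    (Y : Ω → X) : ℝ≥0∞ :=
  ⨆ (U : Ω → ℝ) (_ : IsUniformRV P U),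
    ∫⁻ ω, ENNReal.ofReal (σ (U ω)) * (‖Y ω‖₊ : ℝ≥0∞) ^ p ∂P

/-- The norm `‖Y‖_{σ,p}`. -/
def sigmaNorm (P : Measure Ω) (σ : ℝ → ℝ) (p : ℝ) {X : Type*} [NormedAddCommGroup X]
    (Y : Ω → X) : ℝ≥0∞ :=
  sigmaPow P σ p Y ^ (1 / p)

/-- Membership in `L_σ^p(P,X)`: strongly measurable with finite `σ,p`-norm. -/
def MemLsigma (P : Measure Ω) (σ : ℝ → ℝ) (p : ℝ) {X : Type*} [NormedAddCommGroup X]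
    (Y : Ω → X) : Prop :=
  AEStronglyMeasurable Y P ∧ sigmaPow P σ p Y < ∞

/-- The generalized inverse distribution function (quantile function)
`F_g^{-1}(α) = inf {q : P(g ≤ q) ≥ α}`. -/
def quantileFn (P : Measure Ω) (g : Ω → ℝ) (α : ℝ) : ℝ :=
  sInf {q : ℝ | ENNReal.ofReal α ≤ P {ω | g ω ≤ q}}

variable {𝕂 : Type*} [RCLike 𝕂]

/-- The Köthe dual of `L_σ^p(P)`:
`{Z measurable : Z·Y ∈ L¹(P) for all Y ∈ L_σ^p(P)}`. -/
def KoetheDual (P : Measure Ω) (σ : ℝ → ℝ) (p : ℝ) (Z : Ω → 𝕂) : Prop :=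
  AEStronglyMeasurable Z P ∧
    ∀ Y : Ω → 𝕂, MemLsigma P σ p Y → Integrable (fun ω => Z ω * Y ω) P

/-- The average value-at-risk of level `α` of the (nonnegative) random variable `g`:
`AV@R_α(g) = (1/(1−α)) ∫_α^1 F_g^{-1}(u) du`. -/
def avar (P : Measure Ω) (g : Ω → ℝ) (α : ℝ) : ℝ≥0∞ :=
  ENNReal.ofReal (1 / (1 - α)) *
    ∫⁻ u in Set.Ioo α 1, ENNReal.ofReal (quantileFn P g u)

/-- `Z'` σ-dominates `Z`: there is a uniform `U` with
`AV@R_α(σ(U)·|Z'|) ≥ AV@R_α(|Z|)` for all `α < 1`. -/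
def SigmaDominates (P : Measure Ω) (σ : ℝ → ℝ) (Z' Z : Ω → 𝕂) : Prop :=
  ∃ U : Ω → ℝ, IsUniformRV P U ∧ ∀ α ∈ Set.Ico (0 : ℝ) 1,
    avar P (fun ω => ‖Z ω‖) α ≤ avar P (fun ω => σ (U ω) * ‖Z' ω‖) α

/-- `|Z|*_{σ,∞} = sup_{α ∈ [0,1)} AV@R_α(|Z|) / ((1/(1−α))·S_σ(α))
 = sup_{α ∈ [0,1)} (∫_α^1 F_{|Z|}^{-1}(u) du) / (∫_α^1 σ(u) du)`. -/
def dualNormInf (P : Measure Ω) (σ : ℝ → ℝ) (Z : Ω → 𝕂) : ℝ≥0∞ :=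
  ⨆ (α : ℝ) (_ : α ∈ Set.Ico (0 : ℝ) 1),
    (∫⁻ u in Set.Ioo α 1, ENNReal.ofReal (quantileFn P (fun ω => ‖Z ω‖) u)) /
      ENNReal.ofReal (∫ u in Set.Ioo α 1, σ u)

/-- `|Z|*_{σ,q} = inf {‖Z'‖_{σ,q} : Z' σ-dominates Z}` (with `inf ∅ = ∞`). -/
def dualNormQ (P : Measure Ω) (σ : ℝ → ℝ) (q : ℝ) (Z : Ω → 𝕂) : ℝ≥0∞ :=
  ⨅ (Z' : Ω → 𝕂) (_ : AEStronglyMeasurable Z' P ∧ SigmaDominates P σ Z' Z),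
    sigmaNorm P σ q Z'

section Auxiliary

open Set Filter Topology

/-! ### Quantile functions -/

section Quantile

variable {P : Measure Ω} {g : Ω → ℝ}

theorem quantileFn_le_iff [IsProbabilityMeasure P] (hg : AEMeasurable g P) {u s : ℝ}
    (hu : u ∈ Ioo (0 : ℝ) 1) : quantileFn P g u ≤ s ↔ u ≤ P.real {ω | g ω ≤ s} := by
  have := Measure.isProbabilityMeasure_map (μ := P) hg
  set C := ProbabilityTheory.cdf (P.map g) with hC
  have hCval : ∀ a, C a = P.real {ω | g ω ≤ a} := fun a => by
    rw [hC, ProbabilityTheory.cdf_eq_real, measureReal_def,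
      Measure.map_apply_of_aemeasurable hg measurableSet_Iic]
    rfl
  set A := {a : ℝ | u ≤ C a} with hA
  have hqA : quantileFn P g u = sInf A := by
    unfold quantileFn
    congr 1
    ext a
    simp only [hA, mem_ofPred_eq]
    rw [hCval, measureReal_def, ENNReal.ofReal_le_iff_le_toReal (measure_ne_top _ _)]
  have hne : A.Nonempty := by
    have := (ProbabilityTheory.tendsto_cdf_atTop (P.map g)).eventually (eventually_ge_nhds hu.2)
    exact this.exists
  have hbdd : BddBelow A := by
    have := (ProbabilityTheory.tendsto_cdf_atBot (P.map g)).eventually (eventually_lt_nhds hu.1)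
    obtain ⟨b, hb⟩ := this.exists
    refine ⟨b, fun a ha => ?_⟩
    by_contra! hlt
    exact absurd (le_trans ha (C.mono hlt.le)) (not_le.2 hb)
  rw [hqA, ← hCval]
  refine ⟨fun h => ?_, fun h => csInf_le hbdd h⟩
  have hcont : Tendsto C (𝓝[>] s) (𝓝 (C s)) :=
    (C.right_continuous s).mono_left (nhdsWithin_mono _ Ioi_subset_Ici_self)
  refine ge_of_tendsto hcont ?_
  filter_upwards [self_mem_nhdsWithin] with y (hy : s < y)
  obtain ⟨a, ha, hay⟩ := exists_lt_of_csInf_lt hne (h.trans_lt hy)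
  exact le_trans ha (C.mono hay.le)

theorem monotoneOn_quantileFn [IsProbabilityMeasure P] (hg : AEMeasurable g P) :
    MonotoneOn (quantileFn P g) (Ioo 0 1) := fun _ hu _ hv huv =>
  (quantileFn_le_iff hg hu).2 (huv.trans ((quantileFn_le_iff hg hv).1 le_rfl))

theorem lt_quantileFn_iff [IsProbabilityMeasure P] (hg : AEMeasurable g P) {u s : ℝ}
    (hu : u ∈ Ioo (0 : ℝ) 1) : s < quantileFn P g u ↔ P.real {ω | g ω ≤ s} < u := by
  rw [← not_le, quantileFn_le_iff hg hu, not_le]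

theorem quantileFn_nonneg [IsProbabilityMeasure P] (hg : AEMeasurable g P)
    (h0 : ∀ᵐ ω ∂P, 0 ≤ g ω) {u : ℝ} (hu : u ∈ Ioo (0 : ℝ) 1) : 0 ≤ quantileFn P g u := by
  by_contra! h
  have h1 := (quantileFn_le_iff hg hu).1 le_rfl
  have h2 : P {ω | g ω ≤ quantileFn P g u} = 0 := by
    have h3 : ∀ᵐ ω ∂P, ¬ g ω ≤ quantileFn P g u := by
      filter_upwards [h0] with ω hω
      exact not_le.2 (h.trans_le hω)
    simpa [ae_iff] using h3
  rw [measureReal_def, h2] at h1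
  exact absurd h1 (not_le.2 hu.1)

end Quantile

/-! ### Uniform random variables -/

section Uniform

variable {P : Measure Ω} {U V : Ω → ℝ}

theorem IsUniformRV.measure_le [IsProbabilityMeasure P] (hU : IsUniformRV P U) (a : ℝ) :
    P {ω | U ω ≤ a} = ENNReal.ofReal (min a 1) := by
  rcases le_or_gt a 0 with h0 | h0
  · rw [ENNReal.ofReal_of_nonpos ((min_le_left _ _).trans h0)]
    have h := hU.2.2 0 (by simp)
    rw [ENNReal.ofReal_zero] at h
    exact measure_mono_null (fun ω (hω : U ω ≤ a) => hω.trans h0) h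
  · rcases le_or_gt a 1 with h1 | h1
    · rw [min_eq_left h1]
      exact hU.2.2 a ⟨h0.le, h1⟩
    · rw [min_eq_right h1.le, ENNReal.ofReal_one]
      have : {ω | U ω ≤ a} = univ := eq_univ_of_forall fun ω => (hU.2.1 ω).2.trans h1.le
      rw [this, measure_univ]

theorem IsUniformRV.map_eq [IsProbabilityMeasure P] (hU : IsUniformRV P U) :
    P.map U = volume.restrict (Ioo 0 1) := by
  have := Measure.isProbabilityMeasure_map (μ := P) hU.1.aemeasurable
  rw [restrict_Ioo_eq_restrict_Ioc]
  refine Measure.ext_of_Iic _ _ fun a => ?_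
  rw [Measure.map_apply hU.1 measurableSet_Iic, Measure.restrict_apply measurableSet_Iic,
    inter_comm, Ioc_inter_Iic, Real.volume_Ioc, sub_zero, min_comm]
  exact hU.measure_le a

theorem IsUniformRV.ae_mem [IsProbabilityMeasure P] (hU : IsUniformRV P U) :
    ∀ᵐ ω ∂P, U ω ∈ Ioo (0 : ℝ) 1 := by
  have h : ∀ᵐ u ∂(P.map U), u ∈ Ioo (0 : ℝ) 1 := by
    rw [hU.map_eq]
    exact ae_restrict_mem measurableSet_Ioo
  exact ae_of_ae_map hU.1.aemeasurable h

theorem IsUniformRV.measure_eq [IsProbabilityMeasure P] (hU : IsUniformRV P U) (a : ℝ) :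
    P {ω | U ω = a} = 0 := by
  have h : (P.map U) {a} = 0 := by
    rw [hU.map_eq]
    exact measure_singleton a
  rwa [Measure.map_apply hU.1 (measurableSet_singleton a)] at h

theorem IsUniformRV.ae_ne [IsProbabilityMeasure P] (hU : IsUniformRV P U) (a : ℝ) :
    ∀ᵐ ω ∂P, U ω ≠ a := by
  rw [ae_iff]
  simpa using hU.measure_eq a

theorem IsUniformRV.measure_gt [IsProbabilityMeasure P] (hU : IsUniformRV P U) {a : ℝ}
    (ha : 0 ≤ a) : P {ω | a < U ω} = ENNReal.ofReal (1 - a) := by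
  have h : (P.map U) (Ioi a) = ENNReal.ofReal (1 - a) := by
    rw [hU.map_eq, Measure.restrict_apply measurableSet_Ioi, inter_comm, Ioo_inter_Ioi,
      max_eq_right ha, Real.volume_Ioo]
  rwa [Measure.map_apply hU.1 measurableSet_Ioi] at h

/-- `V` is comonotone with `g`: every strict superlevel set of `g` is, up to a null set,
an upper level set of `V`. -/
def CoMono (P : Measure Ω) (V g : Ω → ℝ) : Prop :=
  ∀ s : ℝ, 0 ≤ s → ∃ c ∈ Icc (0 : ℝ) 1, {ω | s < g ω} =ᵐ[P] {ω | c < V ω}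

/-- The rank of `(g, U)` in the lexicographic order. -/
def lexRank (P : Measure Ω) (g U : Ω → ℝ) (ω : Ω) : ℝ :=
  P.real {ω' | g ω' < g ω ∨ (g ω' = g ω ∧ U ω' ≤ U ω)}

theorem measurable_lexRank [IsProbabilityMeasure P] {g : Ω → ℝ} (hg : Measurable g)
    (hU : Measurable U) : Measurable (lexRank P g U) := by
  have hs : MeasurableSet {x : Ω × Ω | g x.2 < g x.1 ∨ (g x.2 = g x.1 ∧ U x.2 ≤ U x.1)} := by
    have h1 : Measurable fun x : Ω × Ω => g x.1 := by fun_prop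
    have h2 : Measurable fun x : Ω × Ω => g x.2 := by fun_prop
    have h3 : Measurable fun x : Ω × Ω => U x.1 := by fun_prop
    have h4 : Measurable fun x : Ω × Ω => U x.2 := by fun_prop
    exact (measurableSet_lt h2 h1).union
      ((measurableSet_eq_fun h2 h1).inter (measurableSet_le h4 h3))
  exact (measurable_measure_prodMk_left (ν := P) hs).ennreal_toReal

theorem exists_lex_initial [IsProbabilityMeasure P] {g : Ω → ℝ} (hg : Measurable g)
    (hU : IsUniformRV P U) {t : ℝ} (ht : t ∈ Ioo (0 : ℝ) 1) :
    ∃ c x : ℝ, P.real {ω | g ω < c ∨ (g ω = c ∧ U ω ≤ x)} = t := by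
  have hqle : ∀ a, quantileFn P g t ≤ a ↔ t ≤ P.real {ω | g ω ≤ a} := fun a =>
    quantileFn_le_iff hg.aemeasurable ht
  set c := quantileFn P g t with hc
  have h1 : t ≤ P.real {ω | g ω ≤ c} := (hqle c).1 le_rfl
  have h2 : P.real {ω | g ω < c} ≤ t := by
    have hlim := tendsto_measure_iUnion_atTop (μ := P)
      (s := fun n : ℕ => {ω | g ω ≤ c - 1 / (n + 1 : ℝ)}) (by
        intro m n hmn ω hω
        simp only [mem_ofPred_eq] at hω ⊢
        have : (1 : ℝ) / (n + 1) ≤ 1 / (m + 1) := by gcongr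
        linarith)
    have hU' : (⋃ n : ℕ, {ω | g ω ≤ c - 1 / (n + 1 : ℝ)}) = {ω | g ω < c} := by
      ext ω
      simp only [mem_iUnion, mem_ofPred_eq]
      constructor
      · rintro ⟨n, hn⟩
        have : (0 : ℝ) < 1 / (n + 1) := by positivity
        linarith
      · intro h
        obtain ⟨n, hn⟩ := exists_nat_one_div_lt (sub_pos.2 h)
        exact ⟨n, by linarith⟩
    rw [hU'] at hlim
    have : P {ω | g ω < c} ≤ ENNReal.ofReal t := by
      refine le_of_tendsto' hlim fun n => ?_
      have hlt : P.real {ω | g ω ≤ c - 1 / (n + 1 : ℝ)} < t := by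
        by_contra! hle
        have : (0 : ℝ) < 1 / (n + 1) := by positivity
        have := (hqle _).2 hle
        linarith
      rw [Function.comp_apply, ← ENNReal.ofReal_toReal (measure_ne_top P _)]
      exact ENNReal.ofReal_le_ofReal hlt.le
    exact ENNReal.toReal_le_of_le_ofReal ht.1.le this
  set H : ℝ → ℝ := fun x => P.real {ω | g ω < c ∨ (g ω = c ∧ U ω ≤ x)} with hH
  have hmono : Monotone H := fun x y hxy => measureReal_mono (by
    rintro ω (h | ⟨h, h'⟩)
    · exact Or.inl h
    · exact Or.inr ⟨h, h'.trans hxy⟩)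
  have hlip : ∀ x y, x ≤ y → 0 ≤ x → H y - H x ≤ y - x := by
    intro x y hxy hx
    have hsub : {ω | g ω < c ∨ (g ω = c ∧ U ω ≤ y)} ⊆
        {ω | g ω < c ∨ (g ω = c ∧ U ω ≤ x)} ∪ {ω | U ω ∈ Ioc x y} := by
      rintro ω (h | ⟨h, h'⟩)
      · exact Or.inl (Or.inl h)
      · rcases le_or_gt (U ω) x with hx | hx
        · exact Or.inl (Or.inr ⟨h, hx⟩)
        · exact Or.inr ⟨hx, h'⟩
    have h3 : P.real {ω | U ω ∈ Ioc x y} ≤ y - x := by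
      have : P {ω | U ω ∈ Ioc x y} ≤ ENNReal.ofReal (y - x) := by
        have : P {ω | U ω ∈ Ioc x y} = (P.map U) (Ioc x y) :=
          (Measure.map_apply hU.1 measurableSet_Ioc).symm
        rw [this, hU.map_eq, ← Real.volume_Ioc]
        exact Measure.restrict_apply_le _ _
      exact ENNReal.toReal_le_of_le_ofReal (by linarith) this
    have := (measureReal_mono (μ := P) hsub).trans (measureReal_union_le _ _)
    simp only [hH]
    linarith
  have hcont : ContinuousOn H (Icc 0 1) := by
    have : LipschitzOnWith 1 H (Icc 0 1) := by
      refine LipschitzOnWith.of_dist_le_mul fun x hx y hy => ?_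
      rw [NNReal.coe_one, one_mul, Real.dist_eq, Real.dist_eq]
      rcases le_total x y with h | h
      · rw [abs_sub_comm, abs_of_nonneg (sub_nonneg.2 (hmono h)), abs_sub_comm,
          abs_of_nonneg (sub_nonneg.2 h)]
        exact hlip x y h hx.1
      · rw [abs_of_nonneg (sub_nonneg.2 (hmono h)), abs_of_nonneg (sub_nonneg.2 h)]
        exact hlip y x h hy.1
    exact this.continuousOn
  have hH0 : H 0 ≤ t := by
    have hsub : {ω | g ω < c ∨ (g ω = c ∧ U ω ≤ 0)} ⊆ {ω | g ω < c} ∪ {ω | U ω ≤ 0} := by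
      rintro ω (h | h)
      · exact Or.inl h
      · exact Or.inr h.2
    have h0 : P.real {ω | U ω ≤ 0} = 0 := by
      rw [measureReal_def, hU.measure_le]
      simp
    have := (measureReal_mono (μ := P) hsub).trans (measureReal_union_le _ _)
    simp only [hH]
    linarith
  have hH1 : t ≤ H 1 := by
    refine h1.trans (measureReal_mono fun ω hω => ?_)
    rcases lt_or_eq_of_le (show g ω ≤ c from hω) with h | h
    · exact Or.inl h
    · exact Or.inr ⟨h, (hU.2.1 ω).2⟩
  obtain ⟨x, -, hx⟩ := intermediate_value_Icc zero_le_one hcont ⟨hH0, hH1⟩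
  exact ⟨c, x, hx⟩

theorem isUniformRV_lexRank [IsProbabilityMeasure P] {g : Ω → ℝ} (hg : Measurable g)
    (hU : IsUniformRV P U) : IsUniformRV P (lexRank P g U) := by
  set V := lexRank P g U with hV
  have hV1 : ∀ ω, V ω ≤ 1 := fun ω => measureReal_le_one
  have key : ∀ t ∈ Ioo (0 : ℝ) 1,
      P.real {ω | V ω < t} ≤ t ∧ t ≤ P.real {ω | V ω ≤ t} := by
    intro t ht
    obtain ⟨c, x, hB⟩ := exists_lex_initial hg hU ht
    constructor
    · refine (measureReal_mono fun ω hω => ?_).trans_eq hB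
      by_contra hnot
      simp only [mem_ofPred_eq, not_or, not_and, not_lt, not_le] at hnot
      refine absurd (show V ω < t from hω) (not_lt.2 ?_)
      refine hB.ge.trans (measureReal_mono ?_)
      rintro ω' (h | ⟨h, h'⟩)
      · exact Or.inl (h.trans_le hnot.1)
      · rcases lt_or_eq_of_le hnot.1 with h1 | h1
        · exact Or.inl (h ▸ h1)
        · exact Or.inr ⟨h.trans h1, h'.trans (hnot.2 h1.symm).le⟩
    · refine hB.ge.trans (measureReal_mono fun ω hω => ?_)
      refine (measureReal_mono ?_).trans_eq hB
      rintro ω' (h | ⟨h, h'⟩)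
      · rcases hω with h1 | h1
        · exact Or.inl (h.trans h1)
        · exact Or.inl (h1.1 ▸ h)
      · rcases hω with h1 | h1
        · exact Or.inl (h ▸ h1)
        · exact Or.inr ⟨h.trans h1.1, h'.trans h1.2⟩
  refine ⟨measurable_lexRank hg hU.1, fun ω => ⟨measureReal_nonneg, hV1 ω⟩, fun u hu => ?_⟩
  rcases eq_or_lt_of_le hu.2 with h1 | h1
  · have : {ω | V ω ≤ u} = univ := eq_univ_of_forall fun ω => by simpa [h1] using hV1 ω
    rw [this, measure_univ, h1, ENNReal.ofReal_one]
  · have hreal : P.real {ω | V ω ≤ u} = u := by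
      refine le_antisymm ?_ ?_
      · refine le_of_forall_gt_imp_ge_of_dense fun s hs => ?_
        rcases le_or_gt 1 s with hs1 | hs1
        · exact measureReal_le_one.trans hs1
        · refine le_trans (measureReal_mono fun ω (hω : V ω ≤ u) => ?_)
            (key s ⟨hu.1.trans_lt hs, hs1⟩).1
          exact hω.trans_lt hs
      · rcases eq_or_lt_of_le hu.1 with h0 | h0
        · rw [← h0]
          exact measureReal_nonneg
        · exact (key u ⟨h0, h1⟩).2
    rw [← hreal, measureReal_def, ENNReal.ofReal_toReal (measure_ne_top _ _), ← measureReal_def,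
      hreal]

theorem coMono_lexRank [IsProbabilityMeasure P] {g : Ω → ℝ} (hg : Measurable g)
    (hU : IsUniformRV P U) : CoMono P (lexRank P g U) g := by
  intro s _
  refine ⟨P.real {ω | g ω ≤ s}, ⟨measureReal_nonneg, measureReal_le_one⟩, ?_⟩
  have hne : ∀ᵐ ω ∂P, lexRank P g U ω ≠ P.real {ω | g ω ≤ s} :=
    (isUniformRV_lexRank hg hU).ae_ne _
  filter_upwards [hne] with ω hω
  refine propext ⟨fun (h : s < g ω) => ?_, fun (h : _ < lexRank P g U ω) => ?_⟩
  · refine lt_of_le_of_ne (measureReal_mono fun ω' hω' => ?_) hω.symm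
    exact Or.inl (lt_of_le_of_lt hω' h)
  · by_contra hle
    refine absurd h (not_lt.2 (measureReal_mono fun ω' hω' => ?_))
    have hle : g ω ≤ s := not_lt.1 hle
    rcases hω' with h' | h'
    · exact h'.le.trans hle
    · exact h'.1.le.trans hle

/-- On a rich probability space every random variable admits a comonotone uniform one. -/
theorem exists_uniform_coMono [IsProbabilityMeasure P] (hrich : ∃ U : Ω → ℝ, IsUniformRV P U)
    {g : Ω → ℝ} (hg : AEMeasurable g P) : ∃ V : Ω → ℝ, IsUniformRV P V ∧ CoMono P V g := by
  obtain ⟨U, hU⟩ := hrich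
  refine ⟨lexRank P (hg.mk g) U, isUniformRV_lexRank hg.measurable_mk hU, fun s hs => ?_⟩
  obtain ⟨c, hc, h⟩ := coMono_lexRank hg.measurable_mk hU s hs
  refine ⟨c, hc, EventuallyEq.trans ?_ h⟩
  filter_upwards [hg.ae_eq_mk] with ω hω
  show (s < g ω) = (s < hg.mk g ω)
  rw [hω]

theorem coMono_comp_of_monotoneOn [IsProbabilityMeasure P] (hV : IsUniformRV P V) {f : ℝ → ℝ}
    (hf : MonotoneOn f (Ioo 0 1)) : CoMono P V (fun ω => f (V ω)) := by
  intro s _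
  set A := {u ∈ Ioo (0 : ℝ) 1 | s < f u} with hA
  have hbdd : BddBelow A := ⟨0, fun u hu => hu.1.1.le⟩
  by_cases hne : A.Nonempty
  · refine ⟨sInf A, ⟨le_csInf hne fun u hu => hu.1.1.le, ?_⟩, ?_⟩
    · obtain ⟨u, hu⟩ := hne
      exact (csInf_le hbdd hu).trans hu.1.2.le
    · have hVne : ∀ᵐ ω ∂P, V ω ≠ sInf A := hV.ae_ne _
      filter_upwards [hVne, hV.ae_mem] with ω hω hmem
      refine propext ⟨fun (h : s < f (V ω)) => ?_, fun (h : sInf A < V ω) => ?_⟩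
      · exact lt_of_le_of_ne (csInf_le hbdd ⟨hmem, h⟩) hω.symm
      · obtain ⟨u, hu, huV⟩ := exists_lt_of_csInf_lt hne h
        exact lt_of_lt_of_le hu.2 (hf hu.1 hmem huV.le)
  · refine ⟨1, by simp, ?_⟩
    filter_upwards [hV.ae_mem] with ω hmem
    refine propext ⟨fun (h : s < f (V ω)) => (hne ⟨V ω, hmem, h⟩).elim,
      fun (h : 1 < V ω) => absurd hmem.2 (not_lt.2 h.le)⟩

end Uniform

/-! ### Tail integrals and rearrangement -/

section Tail

variable {P : Measure Ω}

/-- The integral of the quantile function of `g` over `(α, 1)`, in layer-cake form. -/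
def tailInt (P : Measure Ω) (g : Ω → ℝ) (α : ℝ) : ℝ≥0∞ :=
  ∫⁻ s in Ioi (0 : ℝ), min (ENNReal.ofReal (1 - α)) (P {ω | s < g ω})

theorem lintegral_quantileFn [IsProbabilityMeasure P] {g : Ω → ℝ} (hg : AEMeasurable g P)
    (h0 : ∀ᵐ ω ∂P, 0 ≤ g ω) {α : ℝ} (hα : α ∈ Ico (0 : ℝ) 1) :
    ∫⁻ u in Ioo α 1, ENNReal.ofReal (quantileFn P g u) = tailInt P g α := by
  have hsub : Ioo α 1 ⊆ Ioo 0 1 := Ioo_subset_Ioo_left hα.1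
  rw [lintegral_eq_lintegral_meas_lt]
  · refine setLIntegral_congr_fun measurableSet_Ioi fun s _ => ?_
    have hset : {u | s < quantileFn P g u} ∩ Ioo α 1 = Ioo (max α (P.real {ω | g ω ≤ s})) 1 := by
      ext u
      simp only [mem_inter_iff, mem_ofPred_eq, mem_Ioo, max_lt_iff]
      constructor
      · rintro ⟨h, h1, h2⟩
        exact ⟨⟨h1, (lt_quantileFn_iff hg (hsub ⟨h1, h2⟩)).1 h⟩, h2⟩
      · rintro ⟨⟨h1, h⟩, h2⟩
        exact ⟨(lt_quantileFn_iff hg (hsub ⟨h1, h2⟩)).2 h, h1, h2⟩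
    have hcompl : P {ω | s < g ω} = ENNReal.ofReal (1 - P.real {ω | g ω ≤ s}) := by
      have hn : NullMeasurableSet {ω | g ω ≤ s} P := nullMeasurableSet_le hg aemeasurable_const
      have : {ω | s < g ω} = {ω | g ω ≤ s}ᶜ := by ext; simp
      rw [this, ← probReal_compl_eq_one_sub₀ hn, measureReal_def,
        ENNReal.ofReal_toReal (measure_ne_top _ _)]
    show (volume.restrict (Ioo α 1)) {u | s < quantileFn P g u} = _
    rw [Measure.restrict_apply' measurableSet_Ioo, hset, Real.volume_Ioo, hcompl,
      ← ENNReal.ofReal_min, min_sub_sub_left]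
  · filter_upwards [ae_restrict_mem measurableSet_Ioo] with u hu
    exact quantileFn_nonneg hg h0 (hsub hu)
  · exact aemeasurable_restrict_of_monotoneOn measurableSet_Ioo
      ((monotoneOn_quantileFn hg).mono hsub)

theorem setLIntegral_le_tailInt {g : Ω → ℝ} (hg : AEMeasurable g P)
    (h0 : ∀ᵐ ω ∂P, 0 ≤ g ω) {α : ℝ} {A : Set Ω} (hA : P A ≤ ENNReal.ofReal (1 - α)) :
    ∫⁻ ω in A, ENNReal.ofReal (g ω) ∂P ≤ tailInt P g α := by
  rw [lintegral_eq_lintegral_meas_lt _ (ae_restrict_of_ae h0) hg.restrict]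
  refine lintegral_mono fun s => le_min ?_ (Measure.restrict_apply_le _ _)
  refine (measure_mono (subset_univ _)).trans ?_
  rwa [Measure.restrict_apply_univ]

theorem setLIntegral_eq_tailInt [IsProbabilityMeasure P] {V : Ω → ℝ} (hV : IsUniformRV P V)
    {g : Ω → ℝ} (hg : AEMeasurable g P) (h0 : ∀ᵐ ω ∂P, 0 ≤ g ω) (hVg : CoMono P V g) {α : ℝ}
    (hα : 0 ≤ α) :
    ∫⁻ ω in {ω | α < V ω}, ENNReal.ofReal (g ω) ∂P = tailInt P g α := by
  rw [lintegral_eq_lintegral_meas_lt _ (ae_restrict_of_ae h0) hg.restrict]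
  refine setLIntegral_congr_fun measurableSet_Ioi fun s hs => ?_
  obtain ⟨c, hc, hset⟩ := hVg s (le_of_lt hs)
  show (P.restrict {ω | α < V ω}) {ω | s < g ω} = _
  rw [Measure.restrict_apply' (measurableSet_lt measurable_const hV.1), measure_congr hset]
  refine (measure_congr (hset.inter (ae_eq_refl {ω | α < V ω}))).trans ?_
  have : {ω | c < V ω} ∩ {ω | α < V ω} = {ω | max α c < V ω} := by
    ext ω
    simp [and_comm]
  rw [this, hV.measure_gt (hα.trans (le_max_left _ _)), hV.measure_gt hc.1,
    ← ENNReal.ofReal_min, min_sub_sub_left]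

theorem tailInt_congr_map {g h : Ω → ℝ} (hgh : ∀ s, P {ω | s < g ω} = P {ω | s < h ω}) (α : ℝ) :
    tailInt P g α = tailInt P h α := by
  simp only [tailInt, hgh]

theorem tailInt_one (g : Ω → ℝ) : tailInt P g 1 = 0 := by
  simp [tailInt]

theorem lintegral_mul_layercake [SFinite P] {h Y : Ω → ℝ} (hh : AEMeasurable h P)
    (hY : AEMeasurable Y P) (hY0 : ∀ᵐ ω ∂P, 0 ≤ Y ω) :
    ∫⁻ ω, ENNReal.ofReal (h ω) * ENNReal.ofReal (Y ω) ∂P =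
      ∫⁻ s in Ioi (0 : ℝ), ∫⁻ ω in {ω | s < Y ω}, ENNReal.ofReal (h ω) ∂P := by
  have hac : P.withDensity (fun ω => ENNReal.ofReal (h ω)) ≪ P :=
    withDensity_absolutelyContinuous _ _
  have := lintegral_withDensity_eq_lintegral_mul₀ (μ := P)
    (f := fun ω => ENNReal.ofReal (h ω)) hh.ennreal_ofReal
    (g := fun ω => ENNReal.ofReal (Y ω)) hY.ennreal_ofReal
  simp only [Pi.mul_apply] at this
  rw [← this, lintegral_eq_lintegral_meas_lt _ (hac.ae_le hY0) (hY.mono_ac hac)]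
  simp only [withDensity_apply']

/-- A Hardy–Littlewood type inequality: tail dominance of `h` by `k` and equality of the
distributions of `Y` and `Y'` give `E[h Y] ≤ E[k Y']` when `k` and `Y'` are comonotone. -/
theorem lintegral_mul_le_of_tailInt_le [IsProbabilityMeasure P] {V h k Y Y' : Ω → ℝ}
    (hV : IsUniformRV P V)
    (hh : AEMeasurable h P) (hh0 : ∀ᵐ ω ∂P, 0 ≤ h ω)
    (hk : AEMeasurable k P) (hk0 : ∀ᵐ ω ∂P, 0 ≤ k ω)
    (hY : AEMeasurable Y P) (hY0 : ∀ᵐ ω ∂P, 0 ≤ Y ω)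
    (hY' : AEMeasurable Y' P) (hY'0 : ∀ᵐ ω ∂P, 0 ≤ Y' ω)
    (hVk : CoMono P V k) (hVY' : CoMono P V Y')
    (hdom : ∀ α ∈ Ico (0 : ℝ) 1, tailInt P h α ≤ tailInt P k α)
    (hlaw : ∀ s, 0 ≤ s → P {ω | s < Y ω} = P {ω | s < Y' ω}) :
    ∫⁻ ω, ENNReal.ofReal (h ω) * ENNReal.ofReal (Y ω) ∂P ≤
      ∫⁻ ω, ENNReal.ofReal (k ω) * ENNReal.ofReal (Y' ω) ∂P := by
  rw [lintegral_mul_layercake hh hY hY0, lintegral_mul_layercake hk hY' hY'0]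
  refine setLIntegral_mono' measurableSet_Ioi fun s hs => ?_
  obtain ⟨c, hc, hset⟩ := hVY' s (le_of_lt hs)
  have hP : P {ω | s < Y ω} = ENNReal.ofReal (1 - c) := by
    rw [hlaw s (le_of_lt hs), measure_congr hset, hV.measure_gt hc.1]
  rw [setLIntegral_congr hset, setLIntegral_eq_tailInt hV hk hk0 hVk hc.1]
  refine (setLIntegral_le_tailInt hh hh0 hP.le).trans ?_
  rcases eq_or_lt_of_le hc.2 with h1 | h1
  · rw [h1, tailInt_one, tailInt_one]
  · exact hdom c ⟨hc.1, h1⟩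

end Tail

/-! ### The level function of a pair of measures -/

section Level

theorem sub_eq_integral_of_antitone {F h : ℝ → ℝ} (hh : Antitone h)
    (hF : ∀ x y, 0 ≤ x → x ≤ y → (y - x) * h y ≤ F x - F y ∧ F x - F y ≤ (y - x) * h x)
    {x y : ℝ} (hx : 0 ≤ x) (hxy : x ≤ y) : F x - F y = ∫ t in x..y, h t := by
  have hint : ∀ a b, IntervalIntegrable h volume a b := fun a b => hh.intervalIntegrable
  set G : ℝ → ℝ := fun t => F t + ∫ s in x..t, h s with hG
  have hstep : ∀ a b, 0 ≤ a → a ≤ b → |G a - G b| ≤ (b - a) * (h a - h b) := by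
    intro a b ha hab
    have h1 := hF a b ha hab
    have h2 : G a - G b = F a - F b - ∫ s in a..b, h s := by
      simp only [hG]
      rw [← intervalIntegral.integral_add_adjacent_intervals (hint x a) (hint a b)]
      ring
    have h3 : ∫ s in a..b, h s ≤ (b - a) * h a := by
      have := intervalIntegral.integral_mono_on hab (hint a b)
        (intervalIntegrable_const (c := h a)) fun t ht => hh ht.1
      simpa using this
    have h4 : (b - a) * h b ≤ ∫ s in a..b, h s := by
      have := intervalIntegral.integral_mono_on hab (intervalIntegrable_const (c := h b))
        (hint a b) fun t ht => hh ht.2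
      simpa using this
    rw [h2, abs_le]
    constructor <;> nlinarith
  have hbound : ∀ n : ℕ, |G x - G y| ≤ (y - x) * (h x - h y) / (n + 1) := by
    intro n
    have hn : (0 : ℝ) < n + 1 := by positivity
    set δ := (y - x) / (n + 1) with hδ
    have hδ0 : 0 ≤ δ := div_nonneg (sub_nonneg.2 hxy) hn.le
    have hend : x + ((n + 1 : ℕ) : ℝ) * δ = y := by
      rw [hδ]
      push_cast
      field_simp
      ring
    have e1 : G x - G y = ∑ i ∈ Finset.range (n + 1),
        (G (x + (i : ℝ) * δ) - G (x + ((i + 1 : ℕ) : ℝ) * δ)) := by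
      rw [Finset.sum_range_sub' (fun i : ℕ => G (x + (i : ℝ) * δ)), hend]
      simp
    have e2 : h x - h y = ∑ i ∈ Finset.range (n + 1),
        (h (x + (i : ℝ) * δ) - h (x + ((i + 1 : ℕ) : ℝ) * δ)) := by
      rw [Finset.sum_range_sub' (fun i : ℕ => h (x + (i : ℝ) * δ)), hend]
      simp
    calc |G x - G y| ≤ ∑ i ∈ Finset.range (n + 1),
        |G (x + (i : ℝ) * δ) - G (x + ((i + 1 : ℕ) : ℝ) * δ)| := by
          rw [e1]
          exact Finset.abs_sum_le_sum_abs _ _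
      _ ≤ ∑ i ∈ Finset.range (n + 1),
          δ * (h (x + (i : ℝ) * δ) - h (x + ((i + 1 : ℕ) : ℝ) * δ)) := by
          refine Finset.sum_le_sum fun i _ => ?_
          have hi : (0 : ℝ) ≤ i * δ := by positivity
          refine (hstep _ _ (by linarith) ?_).trans_eq ?_
          · push_cast
            nlinarith
          · push_cast
            ring
      _ = (y - x) * (h x - h y) / (n + 1) := by
          rw [← Finset.mul_sum, ← e2, hδ]
          ring
  have hlim : Tendsto (fun n : ℕ => (y - x) * (h x - h y) / ((n : ℝ) + 1)) atTop (𝓝 0) := by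
    have := tendsto_one_div_add_atTop_nhds_zero_nat (𝕜 := ℝ)
    simpa [div_eq_mul_inv] using this.const_mul ((y - x) * (h x - h y))
  have hzero : |G x - G y| ≤ 0 := ge_of_tendsto' hlim hbound
  have h0 : G x - G y = 0 := abs_eq_zero.1 (le_antisymm hzero (abs_nonneg _))
  simp only [hG, intervalIntegral.integral_same] at h0
  linarith

theorem exists_monotone_maximizer {N K : ℝ → ℝ} (hN : ContinuousOn N (Icc 0 1))
    (hK : ContinuousOn K (Icc 0 1)) (hNanti : AntitoneOn N (Icc 0 1))
    (hKanti : AntitoneOn K (Icc 0 1)) :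
    ∃ a : ℝ → ℝ, Monotone a ∧ (∀ l, a l ∈ Icc (0 : ℝ) 1) ∧
      ∀ l, 0 ≤ l → ∀ α ∈ Icc (0 : ℝ) 1, N α - l * K α ≤ N (a l) - l * K (a l) := by
  have hex : ∀ l : ℝ, ∃ b, IsLeast {b ∈ Icc (0 : ℝ) 1 |
      ∀ α ∈ Icc (0 : ℝ) 1, N α - l * K α ≤ N b - l * K b} b := by
    intro l
    have hc : ContinuousOn (fun α => N α - l * K α) (Icc 0 1) := hN.sub (hK.const_smul l)
    obtain ⟨b, hb, hbmax⟩ := isCompact_Icc.exists_isMaxOn (nonempty_Icc.2 zero_le_one) hc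
    have hcl : {b ∈ Icc (0 : ℝ) 1 | ∀ α ∈ Icc (0 : ℝ) 1, N α - l * K α ≤ N b - l * K b} =
        Icc 0 1 ∩ (fun α => N α - l * K α) ⁻¹' (Ici (N b - l * K b)) := by
      ext x
      simp only [mem_ofPred_eq, mem_inter_iff, mem_preimage, mem_Ici]
      refine and_congr_right fun hx => ⟨fun h => h b hb, fun h α hα => le_trans ?_ h⟩
      exact hbmax hα
    refine IsCompact.exists_isLeast ?_ ⟨b, hb, fun α hα => hbmax hα⟩
    rw [hcl]
    exact isCompact_Icc.of_isClosed_subset (hc.preimage_isClosed_of_isClosed isClosed_Icc isClosed_Ici)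
      inter_subset_left
  choose b hb using hex
  have hbmem : ∀ l, b l ∈ Icc (0 : ℝ) 1 := fun l => (hb l).1.1
  have hbmax : ∀ l, ∀ α ∈ Icc (0 : ℝ) 1, N α - l * K α ≤ N (b l) - l * K (b l) :=
    fun l => (hb l).1.2
  have hbmono : Monotone b := by
    intro l m hlm
    by_contra! hlt
    have hKle := hKanti (hbmem m) (hbmem l) hlt.le
    have hNle := hNanti (hbmem m) (hbmem l) hlt.le
    have h1 := hbmax l (b m) (hbmem m)
    have h2 := hbmax m (b l) (hbmem l)
    refine absurd ((hb l).2 ⟨hbmem m, fun α hα => (hbmax l α hα).trans ?_⟩) (not_le.2 hlt)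
    nlinarith
  exact ⟨b, hbmono, hbmem, fun l _ => hbmax l⟩

theorem lintegral_Ioi_maximizer {N K a : ℝ → ℝ} (hN : ContinuousOn N (Icc 0 1))
    (hNanti : AntitoneOn N (Icc 0 1)) (hKanti : AntitoneOn K (Icc 0 1))
    (hN1 : N 1 = 0) (hK1 : K 1 = 0) (hKpos : ∀ α ∈ Ico (0 : ℝ) 1, 0 < K α)
    (ha : Monotone a) (hmem : ∀ l, a l ∈ Icc (0 : ℝ) 1)
    (hmax : ∀ l, 0 ≤ l → ∀ α ∈ Icc (0 : ℝ) 1, N α - l * K α ≤ N (a l) - l * K (a l))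
    {l : ℝ} (hl : 0 ≤ l) :
    ∫⁻ t in Ioi l, ENNReal.ofReal (K (a t)) = ENNReal.ofReal (N (a l) - l * K (a l)) := by
  have h1mem : (1 : ℝ) ∈ Icc (0 : ℝ) 1 := by simp
  set F : ℝ → ℝ := fun t => N (a t) - t * K (a t) with hF
  have hh : Antitone (fun t => K (a t)) := fun s t hst => hKanti (hmem s) (hmem t) (ha hst)
  have hK0 : ∀ α ∈ Icc (0 : ℝ) 1, 0 ≤ K α := fun α hα => hK1 ▸ hKanti hα h1mem hα.2
  have hF0 : ∀ t, 0 ≤ t → 0 ≤ F t := fun t ht => by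
    have := hmax t ht 1 h1mem
    simpa only [hN1, hK1, mul_zero, sub_zero] using this
  have hFint : ∀ y, l ≤ y → F l - F y = ∫ t in l..y, K (a t) := fun y hy =>
    sub_eq_integral_of_antitone hh (fun x y hx hxy => by
      have h1 := hmax x hx (a y) (hmem y)
      have h2 := hmax y (hx.trans hxy) (a x) (hmem x)
      simp only [hF]
      constructor <;> linarith) hl hy
  have hKlim : Tendsto (fun n : ℕ => K (a n)) atTop (𝓝 0) := by
    have hb : Tendsto (fun n : ℕ => N 0 / (n : ℝ)) atTop (𝓝 0) :=
      tendsto_const_div_atTop_nhds_zero_nat _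
    refine tendsto_of_tendsto_of_tendsto_of_le_of_le' tendsto_const_nhds hb
      (Eventually.of_forall fun n => hK0 _ (hmem _)) ?_
    filter_upwards [eventually_gt_atTop 0] with n hn
    have hn' : (0 : ℝ) < n := by exact_mod_cast hn
    rw [le_div_iff₀ hn']
    have := hF0 n hn'.le
    have h3 := hNanti (by simp) (hmem (n : ℝ)) (hmem (n : ℝ)).1
    simp only [hF] at this
    linarith
  have halim : Tendsto (fun n : ℕ => a n) atTop (𝓝[Icc 0 1] 1) := by
    refine tendsto_nhdsWithin_iff.2 ⟨?_, Eventually.of_forall fun n => hmem _⟩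
    refine tendsto_order.2 ⟨fun b hb => ?_, fun b hb =>
      Eventually.of_forall fun n => (hmem _).2.trans_lt hb⟩
    rcases lt_or_ge b 0 with hb0 | hb0
    · exact Eventually.of_forall fun n => hb0.trans_le (hmem _).1
    · filter_upwards [hKlim.eventually (eventually_lt_nhds (hKpos b ⟨hb0, hb⟩))] with n hn
      by_contra! hle
      exact absurd hn (not_lt.2 (hKanti (hmem _) ⟨hb0, hb.le⟩ hle))
  have hFlim : Tendsto (fun n : ℕ => F n) atTop (𝓝 0) := by
    have hb : Tendsto (fun n : ℕ => N (a n)) atTop (𝓝 0) := hN1 ▸ (hN 1 h1mem).tendsto.comp halim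
    refine tendsto_of_tendsto_of_tendsto_of_le_of_le tendsto_const_nhds hb
      (fun n => hF0 n n.cast_nonneg) fun n => ?_
    simp only [hF]
    have := mul_nonneg (n.cast_nonneg (α := ℝ)) (hK0 _ (hmem n))
    linarith
  have hcov : AECover (volume.restrict (Ioi l)) atTop fun n : ℕ => Iic (n : ℝ) :=
    aecover_Iic tendsto_natCast_atTop_atTop
  refine hcov.lintegral_eq_of_tendsto _ hh.measurable.ennreal_ofReal.aemeasurable ?_
  have hlim : Tendsto (fun n : ℕ => ENNReal.ofReal (F l - F n)) atTop (𝓝 (ENNReal.ofReal (F l))) := by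
    have := (tendsto_const_nhds (x := F l)).sub hFlim
    rw [sub_zero] at this
    exact ENNReal.tendsto_ofReal this
  refine hlim.congr' ?_
  filter_upwards [eventually_ge_atTop ⌈l⌉₊] with n hn
  have hln : l ≤ n := (Nat.le_ceil l).trans (by exact_mod_cast hn)
  rw [Measure.restrict_restrict measurableSet_Iic, inter_comm, Ioi_inter_Iic,
    hFint n hln, intervalIntegral.integral_of_le hln,
    ofReal_integral_eq_lintegral_ofReal hh.intervalIntegrable.1
      (Eventually.of_forall fun t => hK0 _ (hmem t))]

theorem ae_eq_Ioo_of_lower {D : Set ℝ} (hpos : D ⊆ Ioi 0)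
    (hlow : ∀ t ∈ D, ∀ s, 0 < s → s ≤ t → s ∈ D) (hfin : volume D ≠ ∞) :
    D =ᵐ[volume] Ioo 0 (volume D).toReal := by
  have h1 : Ioo 0 (volume D).toReal ⊆ D := by
    intro t ht
    by_contra hnot
    have hsub : D ⊆ Ioo 0 t := fun s hs => ⟨hpos hs, by
      by_contra! hle
      exact hnot (hlow s hs t ht.1 hle)⟩
    have := measure_mono (μ := volume) hsub
    rw [Real.volume_Ioo, sub_zero] at this
    exact absurd (ENNReal.toReal_le_of_le_ofReal ht.1.le this) (not_le.2 ht.2)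
  have h2 : D ⊆ Ioc 0 (volume D).toReal := by
    intro t ht
    refine ⟨hpos ht, ?_⟩
    have hsub : Ioc 0 t ⊆ D := fun s hs => hlow t ht s hs.1 hs.2
    have := measure_mono (μ := volume) hsub
    rw [Real.volume_Ioc, sub_zero] at this
    exact (ENNReal.ofReal_le_iff_le_toReal hfin).1 this
  exact EventuallyLE.antisymm
    (h2.eventuallyLE.trans Ioo_ae_eq_Ioc.symm.le) h1.eventuallyLE

theorem lintegral_level_swap (κ : Measure ℝ) [SFinite κ] {a : ℝ → ℝ} (ha : Measurable a)
    {φ ψ : ℝ → ℝ≥0∞} (hφ : Measurable φ) (hψ : Measurable ψ) :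
    ∫⁻ u, ψ u * (∫⁻ l in {l | 0 < l ∧ a l < u}, φ l) ∂κ =
      ∫⁻ l in Ioi 0, φ l * ∫⁻ u in Ioi (a l), ψ u ∂κ := by
  have hm : MeasurableSet {z : ℝ × ℝ | 0 < z.2 ∧ a z.2 < z.1} :=
    (measurableSet_lt measurable_const measurable_snd).inter
      (measurableSet_lt (ha.comp measurable_snd) measurable_fst)
  have hL : ∀ u, MeasurableSet {l | 0 < l ∧ a l < u} := fun u =>
    (measurableSet_lt measurable_const measurable_id).inter (measurableSet_lt ha measurable_const)
  set f : ℝ → ℝ → ℝ≥0∞ := fun u l =>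
    {z : ℝ × ℝ | 0 < z.2 ∧ a z.2 < z.1}.indicator (fun z => ψ z.1 * φ z.2) (u, l) with hf
  have hfm : Measurable (Function.uncurry f) :=
    ((hψ.comp measurable_fst).mul (hφ.comp measurable_snd)).indicator hm
  have e1 : ∀ u, ψ u * (∫⁻ l in {l | 0 < l ∧ a l < u}, φ l) = ∫⁻ l, f u l := by
    intro u
    rw [← lintegral_const_mul _ hφ, ← lintegral_indicator (hL u)]
    rfl
  have e2 : ∀ l, ∫⁻ u, f u l ∂κ =
      (Ioi (0 : ℝ)).indicator (fun l => φ l * ∫⁻ u in Ioi (a l), ψ u ∂κ) l := by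
    intro l
    by_cases hl : l ∈ Ioi (0 : ℝ)
    · rw [indicator_of_mem hl, ← lintegral_const_mul _ hψ, ← lintegral_indicator measurableSet_Ioi]
      refine lintegral_congr fun u => ?_
      have hl' : 0 < l := hl
      simp only [hf, indicator, mem_ofPred_eq, mem_Ioi, hl', true_and, mul_comm]
    · rw [indicator_of_notMem hl]
      have hl' : ¬ 0 < l := hl
      simp [hf, indicator, hl']
  rw [lintegral_congr e1, lintegral_lintegral_swap hfm.aemeasurable, lintegral_congr e2,
    lintegral_indicator measurableSet_Ioi]

theorem continuousOn_measureReal_Ioi (ν : Measure ℝ) [IsFiniteMeasure ν]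
    [NullSingletonClass ν] : ContinuousOn (fun α => ν.real (Ioi α)) (Icc 0 1) := by
  have h := (intervalIntegral.continuous_primitive (μ := ν) (f := fun _ => (1 : ℝ))
    (fun a b => intervalIntegrable_const) 0)
  have h2 : Continuous fun b => ν.real (Ioi 0) - ∫ _ in (0 : ℝ)..b, (1 : ℝ) ∂ν :=
    continuous_const.sub h
  refine h2.continuousOn.congr fun α hα => ?_
  simp only
  rw [intervalIntegral.integral_of_le hα.1, setIntegral_const, smul_eq_mul, mul_one,
    eq_sub_iff_add_eq, ← measureReal_union (Ioc_disjoint_Ioi le_rfl).symm measurableSet_Ioc,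
    union_comm, Ioc_union_Ioi_eq_Ioi hα.1]

/-- The level function of `ν` with respect to `κ`: the density `x` with respect to `κ` of the
least concave majorant of the tails of `ν`. -/
theorem exists_level_function (ν κ : Measure ℝ) [IsFiniteMeasure ν] [IsFiniteMeasure κ]
    [NullSingletonClass ν] [NullSingletonClass κ] (hν1 : ν (Ici 1) = 0) (hκ1 : κ (Ici 1) = 0)
    (hκ : ∀ α ∈ Ico (0 : ℝ) 1, κ (Ioi α) ≠ 0) :
    ∃ x : ℝ → ℝ, Measurable x ∧ (∀ u, 0 ≤ x u) ∧ MonotoneOn x (Iio 1) ∧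
      (∀ α ∈ Ico (0 : ℝ) 1, ν (Ioi α) ≤ ∫⁻ u in Ioi α, ENNReal.ofReal (x u) ∂κ) ∧
      ∀ φ : ℝ → ℝ≥0∞, Measurable φ →
        ∫⁻ u, (∫⁻ l in Ioo 0 (x u), φ l) ∂ν =
          ∫⁻ u, ENNReal.ofReal (x u) * (∫⁻ l in Ioo 0 (x u), φ l) ∂κ := by
  set N : ℝ → ℝ := fun α => ν.real (Ioi α) with hN
  set K : ℝ → ℝ := fun α => κ.real (Ioi α) with hK
  have hNc : ContinuousOn N (Icc 0 1) := continuousOn_measureReal_Ioi ν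
  have hKc : ContinuousOn K (Icc 0 1) := continuousOn_measureReal_Ioi κ
  have hNanti : Antitone N := fun s t hst => measureReal_mono (Ioi_subset_Ioi hst)
  have hKanti : Antitone K := fun s t hst => measureReal_mono (Ioi_subset_Ioi hst)
  have hN1 : N 1 = 0 := by
    simp only [hN, measureReal_def, measure_mono_null Ioi_subset_Ici_self hν1, ENNReal.toReal_zero]
  have hK1 : K 1 = 0 := by
    simp only [hK, measureReal_def, measure_mono_null Ioi_subset_Ici_self hκ1, ENNReal.toReal_zero]
  have hKpos : ∀ α ∈ Ico (0 : ℝ) 1, 0 < K α := fun α hα =>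
    ENNReal.toReal_pos (hκ α hα) (measure_ne_top _ _)
  have hνof : ∀ α, ν (Ioi α) = ENNReal.ofReal (N α) := fun α =>
    (ENNReal.ofReal_toReal (measure_ne_top _ _)).symm
  have hκof : ∀ α, κ (Ioi α) = ENNReal.ofReal (K α) := fun α =>
    (ENNReal.ofReal_toReal (measure_ne_top _ _)).symm
  obtain ⟨a, ha, hmem, hmax⟩ := exists_monotone_maximizer hNc hKc
    (hNanti.antitoneOn _) (hKanti.antitoneOn _)
  have hFl : ∀ l, 0 ≤ l → ∫⁻ t in Ioi l, ENNReal.ofReal (K (a t)) =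
      ENNReal.ofReal (N (a l) - l * K (a l)) := fun l hl =>
    lintegral_Ioi_maximizer hNc (hNanti.antitoneOn _) (hKanti.antitoneOn _) hN1 hK1 hKpos ha hmem
      hmax hl
  set L : ℝ → Set ℝ := fun u => {l | 0 < l ∧ a l < u} with hL
  have hLmono : Monotone L := fun u v huv l hl => ⟨hl.1, hl.2.trans_le huv⟩
  have hLfin : ∀ u < 1, volume (L u) ≠ ∞ := by
    intro u hu
    have hex : ∃ l, 0 < l ∧ u ≤ a l := by
      rcases lt_or_ge u 0 with h0 | h0
      · exact ⟨1, one_pos, h0.le.trans (hmem 1).1⟩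
      · have hKu := hKpos u ⟨h0, hu⟩
        have hN0 : 0 ≤ N 0 := measureReal_nonneg
        set l := N 0 / K u + 1 with hl
        have hlpos : 0 < l := by positivity
        refine ⟨l, hlpos, ?_⟩
        by_contra! hlt
        have h1 := hmax l hlpos.le 1 (by simp)
        rw [hN1, hK1] at h1
        have h2 := hKanti hlt.le
        have h3 := hNanti (hmem l).1
        have h4 : l * K u = N 0 + K u := by
          rw [hl]
          field_simp
        nlinarith
    obtain ⟨l, hl, hul⟩ := hex
    have hsub : L u ⊆ Ioo 0 l := fun t ht => ⟨ht.1, by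
      by_contra! hle
      exact absurd (ha hle) (not_le.2 (ht.2.trans_le hul))⟩
    refine ne_top_of_le_ne_top ?_ (measure_mono hsub)
    simp
  set x : ℝ → ℝ := fun u => (volume (L u)).toReal with hx
  have hwm : Measurable fun u => volume (L u) :=
    Monotone.measurable fun u v huv => measure_mono (hLmono huv)
  have hLae : ∀ u < 1, L u =ᵐ[volume] Ioo 0 (x u) := fun u hu =>
    ae_eq_Ioo_of_lower (fun l hl => hl.1)
      (fun t ht s hs hst => ⟨hs, (ha hst).trans_lt ht.2⟩) (hLfin u hu)
  have hxw : ∀ u < 1, ENNReal.ofReal (x u) = volume (L u) := fun u hu =>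
    ENNReal.ofReal_toReal (hLfin u hu)
  have hκae : ∀ᵐ u ∂κ, u < 1 := by
    simpa [ae_iff, Ici] using hκ1
  have hνae : ∀ᵐ u ∂ν, u < 1 := by
    simpa [ae_iff, Ici] using hν1
  have claim : ∀ α ∈ Icc (0 : ℝ) 1, ∀ l, 0 ≤ l → (∀ m, 0 < m → m < l → a m ≤ α) →
      (∀ m, l < m → α ≤ a m) → ∫⁻ u in Ioi α, ENNReal.ofReal (x u) ∂κ =
        ENNReal.ofReal (l * K α) + ENNReal.ofReal (N (a l) - l * K (a l)) := by
    intro α hα l hl hlo hhi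
    have e1 : ∫⁻ u in Ioi α, ENNReal.ofReal (x u) ∂κ =
        ∫⁻ u, (Ioi α).indicator 1 u * (∫⁻ _ in L u, 1) ∂κ := by
      rw [← lintegral_indicator measurableSet_Ioi]
      refine lintegral_congr_ae ?_
      filter_upwards [hκae] with u hu
      rw [setLIntegral_one, ← hxw u hu]
      by_cases h : u ∈ Ioi α <;> simp [h]
    have e2 : ∀ m, (1 : ℝ≥0∞) * ∫⁻ u in Ioi (a m), (Ioi α).indicator 1 u ∂κ =
        ENNReal.ofReal (K (max α (a m))) := by
      intro m
      rw [one_mul, lintegral_indicator_one measurableSet_Ioi, Measure.restrict_apply measurableSet_Ioi,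
        Ioi_inter_Ioi, hκof]
    rw [e1, lintegral_level_swap κ ha.measurable measurable_const
      (measurable_one.indicator measurableSet_Ioi), ← Ioc_union_Ioi_eq_Ioi hl,
      lintegral_union measurableSet_Ioi (Ioc_disjoint_Ioi le_rfl)]
    congr 1
    · rw [← restrict_Ioo_eq_restrict_Ioc]
      rw [setLIntegral_congr_fun (g := fun _ => ENNReal.ofReal (K α)) measurableSet_Ioo fun m hm => by
        simp only [e2, max_eq_left (hlo m hm.1 hm.2)], setLIntegral_const, Real.volume_Ioo, sub_zero,
        ENNReal.ofReal_mul hl, mul_comm]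
    · rw [← hFl l hl]
      exact setLIntegral_congr_fun measurableSet_Ioi fun m hm => by
        simp only [e2, max_eq_right (hhi m hm)]
  refine ⟨x, hwm.ennreal_toReal, fun u => ENNReal.toReal_nonneg, fun u _ v hv huv =>
    ENNReal.toReal_mono (hLfin v hv) (measure_mono (hLmono huv)), fun α hα => ?_, fun φ hφ => ?_⟩
  · have hx0 : 0 ≤ x α := ENNReal.toReal_nonneg
    have hsubL : Ioo 0 (x α) ⊆ L α := by
      intro m hm
      by_contra hnot
      have hsub : L α ⊆ Ioo 0 m := fun t ht => ⟨ht.1, by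
        by_contra! hle
        exact hnot ⟨hm.1, (ha hle).trans_lt ht.2⟩⟩
      have := measure_mono (μ := volume) hsub
      rw [Real.volume_Ioo, sub_zero] at this
      exact absurd (ENNReal.toReal_le_of_le_ofReal hm.1.le this) (not_le.2 hm.2)
    have hsupL : ∀ m, x α < m → α ≤ a m := by
      intro m hm
      by_contra! hlt
      have hsub : Ioc 0 m ⊆ L α := fun s hs => ⟨hs.1, (ha hs.2).trans_lt hlt⟩
      have := measure_mono (μ := volume) hsub
      rw [Real.volume_Ioc, sub_zero] at this
      exact absurd ((ENNReal.ofReal_le_iff_le_toReal (hLfin α hα.2)).1 this) (not_le.2 hm)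
    rw [claim α ⟨hα.1, hα.2.le⟩ (x α) hx0 (fun m h0 h1 => (hsubL ⟨h0, h1⟩).2.le) hsupL, hνof]
    have h1 := hmax (x α) hx0 α ⟨hα.1, hα.2.le⟩
    refine le_trans (ENNReal.ofReal_le_ofReal ?_) ENNReal.ofReal_add_le
    linarith
  · have hE : ∀ l, 0 ≤ l → ∫⁻ u in Ioi (a l), ENNReal.ofReal (x u) ∂κ = ν (Ioi (a l)) := by
      intro l hl
      have h1 := hmax l hl 1 (by simp)
      rw [hN1, hK1] at h1
      rw [claim (a l) (hmem l) l hl (fun m _ h => ha h.le) (fun m h => ha h.le), hνof,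
        ← ENNReal.ofReal_add (mul_nonneg hl measureReal_nonneg) (by linarith)]
      congr 1
      ring
    have e1 : ∫⁻ u, (∫⁻ l in Ioo 0 (x u), φ l) ∂ν = ∫⁻ u, 1 * (∫⁻ l in L u, φ l) ∂ν := by
      refine lintegral_congr_ae ?_
      filter_upwards [hνae] with u hu
      rw [one_mul, setLIntegral_congr (hLae u hu)]
    have e2 : ∫⁻ u, ENNReal.ofReal (x u) * (∫⁻ l in Ioo 0 (x u), φ l) ∂κ =
        ∫⁻ u, ENNReal.ofReal (x u) * (∫⁻ l in L u, φ l) ∂κ := by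
      refine lintegral_congr_ae ?_
      filter_upwards [hκae] with u hu
      rw [setLIntegral_congr (hLae u hu)]
    rw [e1, e2, lintegral_level_swap ν ha.measurable hφ measurable_const,
      lintegral_level_swap κ ha.measurable hφ hwm.ennreal_toReal.ennreal_ofReal]
    refine setLIntegral_congr_fun measurableSet_Ioi fun l hl => ?_
    simp only [setLIntegral_one]
    rw [← hE l (le_of_lt hl)]

end Level

/-! ### Distortion functions and the norm `‖·‖_{σ,p}` -/

section Distortion

variable {P : Measure Ω} {σ : ℝ → ℝ} {U V : Ω → ℝ}

theorem IsUniformRV.aemeasurable_comp [IsProbabilityMeasure P] (hU : IsUniformRV P U) {f : ℝ → ℝ}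
    (hf : MonotoneOn f (Ioo 0 1)) : AEMeasurable (fun ω => f (U ω)) P := by
  have h1 : AEMeasurable f (P.map U) := by
    rw [hU.map_eq]
    exact aemeasurable_restrict_of_monotoneOn measurableSet_Ioo hf
  exact h1.comp_measurable hU.1

theorem IsUniformRV.measure_lt_comp_eq [IsProbabilityMeasure P] (hU : IsUniformRV P U)
    (hV : IsUniformRV P V) {f : ℝ → ℝ} (hf : MonotoneOn f (Ioo 0 1)) (s : ℝ) :
    P {ω | s < f (U ω)} = P {ω | s < f (V ω)} := by
  have key : ∀ W : Ω → ℝ, IsUniformRV P W →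
      P {ω | s < f (W ω)} = volume.restrict (Ioo (0 : ℝ) 1) (f ⁻¹' Ioi s) := by
    intro W hW
    have h1 : AEMeasurable f (P.map W) := by
      rw [hW.map_eq]
      exact aemeasurable_restrict_of_monotoneOn measurableSet_Ioo hf
    rw [← hW.map_eq, Measure.map_apply₀ hW.1.aemeasurable (h1.nullMeasurable measurableSet_Ioi)]
    rfl
  rw [key U hU, key V hV]

theorem IsDistortion.monotoneOn (hσ : IsDistortion σ) : MonotoneOn σ (Ioo 0 1) :=
  hσ.mono.mono Ioo_subset_Ico_self

theorem IsDistortion.ae_nonneg [IsProbabilityMeasure P] (hσ : IsDistortion σ)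
    (hU : IsUniformRV P U) : ∀ᵐ ω ∂P, 0 ≤ σ (U ω) := by
  filter_upwards [hU.ae_mem] with ω h using hσ.nonneg _ (Ioo_subset_Ico_self h)

theorem IsDistortion.lintegral_comp [IsProbabilityMeasure P] (hσ : IsDistortion σ)
    (hU : IsUniformRV P U) : ∫⁻ ω, ENNReal.ofReal (σ (U ω)) ∂P = 1 := by
  have hm : AEMeasurable σ (volume.restrict (Ioo 0 1)) :=
    aemeasurable_restrict_of_monotoneOn measurableSet_Ioo hσ.monotoneOn
  have hint : Integrable σ (volume.restrict (Ioo 0 1)) := by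
    by_contra h
    have := hσ.integral_one
    rw [integral_undef h] at this
    exact zero_ne_one this
  have h1 : ∫⁻ ω, ENNReal.ofReal (σ (U ω)) ∂P = ∫⁻ u, ENNReal.ofReal (σ u) ∂(P.map U) := by
    rw [lintegral_map' _ hU.1.aemeasurable]
    rw [hU.map_eq]
    exact hm.ennreal_ofReal
  rw [h1, hU.map_eq, ← ofReal_integral_eq_lintegral_ofReal hint, hσ.integral_one,
    ENNReal.ofReal_one]
  filter_upwards [ae_restrict_mem measurableSet_Ioo] with u hu
  exact hσ.nonneg u (Ioo_subset_Ico_self hu)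

theorem IsDistortion.setLIntegral_ne_zero [IsProbabilityMeasure P] (hσ : IsDistortion σ)
    (hV : IsUniformRV P V) {α : ℝ} (hα : α ∈ Ico (0 : ℝ) 1) :
    ∫⁻ ω in {ω | α < V ω}, ENNReal.ofReal (σ (V ω)) ∂P ≠ 0 := by
  intro h0
  have hmeas : MeasurableSet {ω | α < V ω} := measurableSet_lt measurable_const hV.1
  rw [lintegral_eq_zero_iff'
    (hV.aemeasurable_comp hσ.monotoneOn).ennreal_ofReal.restrict] at h0
  have h1 := (ae_restrict_iff' hmeas).1 h0
  have hle : ∀ u ∈ Ioo (0 : ℝ) 1, σ u ≤ 0 := by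
    intro u hu
    have hpos : P {ω | max u α < V ω} ≠ 0 := by
      rw [hV.measure_gt (le_max_of_le_left hu.1.le)]
      simpa using ⟨hu.2, hα.2⟩
    obtain ⟨ω, hω, h2, h3⟩ := ((frequently_ae_iff.2 hpos).and_eventually
      (h1.and hV.ae_mem)).exists
    have h4 : σ (V ω) ≤ 0 := by simpa using h2 ((le_max_right _ _).trans_lt hω)
    exact (hσ.monotoneOn hu h3 ((le_max_left _ _).trans hω.le)).trans h4
  have := setIntegral_nonpos (μ := volume) measurableSet_Ioo hle
  rw [hσ.integral_one] at this
  linarith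

theorem IsDistortion.lintegral_mul_le [IsProbabilityMeasure P] (hσ : IsDistortion σ)
    (hU : IsUniformRV P U) (hV : IsUniformRV P V) {Y Y' : Ω → ℝ}
    (hY : AEMeasurable Y P) (hY0 : ∀ᵐ ω ∂P, 0 ≤ Y ω)
    (hY' : AEMeasurable Y' P) (hY'0 : ∀ᵐ ω ∂P, 0 ≤ Y' ω) (hVY' : CoMono P V Y')
    (hlaw : ∀ s, 0 ≤ s → P {ω | s < Y ω} = P {ω | s < Y' ω}) :
    ∫⁻ ω, ENNReal.ofReal (σ (U ω)) * ENNReal.ofReal (Y ω) ∂P ≤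
      ∫⁻ ω, ENNReal.ofReal (σ (V ω)) * ENNReal.ofReal (Y' ω) ∂P :=
  lintegral_mul_le_of_tailInt_le hV (hU.aemeasurable_comp hσ.monotoneOn) (hσ.ae_nonneg hU)
    (hV.aemeasurable_comp hσ.monotoneOn) (hσ.ae_nonneg hV) hY hY0 hY' hY'0
    (coMono_comp_of_monotoneOn hV hσ.monotoneOn) hVY'
    (fun α _ => (tailInt_congr_map (hU.measure_lt_comp_eq hV hσ.monotoneOn) α).le) hlaw

theorem coe_nnnorm_rpow {X : Type*} [NormedAddCommGroup X] (x : X) {p : ℝ} (hp : 0 ≤ p) :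
    (‖x‖₊ : ℝ≥0∞) ^ p = ENNReal.ofReal (‖x‖ ^ p) := by
  rw [← ENNReal.ofReal_rpow_of_nonneg (norm_nonneg x) hp, ofReal_norm]
  rfl

theorem IsDistortion.sigmaPow_eq [IsProbabilityMeasure P] (hσ : IsDistortion σ)
    (hV : IsUniformRV P V) {X : Type*} [NormedAddCommGroup X] {Y : Ω → X} {p : ℝ} (hp : 0 ≤ p)
    (hY : AEStronglyMeasurable Y P) (hVY : CoMono P V (fun ω => ‖Y ω‖ ^ p)) :
    sigmaPow P σ p Y = ∫⁻ ω, ENNReal.ofReal (σ (V ω)) * (‖Y ω‖₊ : ℝ≥0∞) ^ p ∂P := by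
  have hm : AEMeasurable (fun ω => ‖Y ω‖ ^ p) P := hY.norm.aemeasurable.pow_const p
  have h0 : ∀ᵐ ω ∂P, 0 ≤ ‖Y ω‖ ^ p := ae_of_all _ fun ω => Real.rpow_nonneg (norm_nonneg _) p
  refine le_antisymm (iSup₂_le fun U hU => ?_) (le_iSup₂_of_le V hV le_rfl)
  simp only [coe_nnnorm_rpow _ hp]
  exact hσ.lintegral_mul_le hU hV hm h0 hm h0 hVY fun _ _ => rfl

end Distortion

/-! ### Hölder's inequality under σ-dominance -/

section Holder

variable {P : Measure Ω} {σ : ℝ → ℝ} {p q : ℝ}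

theorem IsUniformRV.measure_lt_quantileFn [IsProbabilityMeasure P] {V g : Ω → ℝ}
    (hV : IsUniformRV P V) (hg : AEMeasurable g P) (s : ℝ) :
    P {ω | s < quantileFn P g (V ω)} = P {ω | s < g ω} := by
  have h1 : {ω | s < quantileFn P g (V ω)} =ᵐ[P] {ω | P.real {ω | g ω ≤ s} < V ω} := by
    filter_upwards [hV.ae_mem] with ω hω
    exact propext (lt_quantileFn_iff hg hω)
  have h2 : {ω | s < g ω} = {ω | g ω ≤ s}ᶜ := by
    ext ω
    simp
  have h3 : NullMeasurableSet {ω | g ω ≤ s} P := hg.nullMeasurable measurableSet_Iic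
  rw [measure_congr h1, hV.measure_gt measureReal_nonneg, h2, prob_compl_eq_one_sub₀ h3,
    ENNReal.ofReal_sub _ measureReal_nonneg, ENNReal.ofReal_one, ofReal_measureReal]

theorem avar_le_avar_iff [IsProbabilityMeasure P] {g h : Ω → ℝ} (hg : AEMeasurable g P)
    (hg0 : ∀ᵐ ω ∂P, 0 ≤ g ω) (hh : AEMeasurable h P) (hh0 : ∀ᵐ ω ∂P, 0 ≤ h ω) {α : ℝ}
    (hα : α ∈ Ico (0 : ℝ) 1) :
    avar P g α ≤ avar P h α ↔ tailInt P g α ≤ tailInt P h α := by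
  have hpos : 0 < 1 / (1 - α) := one_div_pos.2 (sub_pos.2 hα.2)
  rw [avar, avar, lintegral_quantileFn hg hg0 hα, lintegral_quantileFn hh hh0 hα]
  exact ENNReal.mul_le_mul_iff_right (ENNReal.ofReal_pos.2 hpos).ne' ENNReal.ofReal_ne_top

theorem IsDistortion.lintegral_rpow_le_sigmaPow [IsProbabilityMeasure P]
    (hrich : ∃ U : Ω → ℝ, IsUniformRV P U) (hσ : IsDistortion σ) {U W : Ω → ℝ}
    (hU : IsUniformRV P U) {X : Type*} [NormedAddCommGroup X] {Y : Ω → X} (hp : 0 < p)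
    (hY : AEStronglyMeasurable Y P) (hW : AEMeasurable W P) (hW0 : ∀ᵐ ω ∂P, 0 ≤ W ω)
    (hlaw : ∀ s, P {ω | s < W ω} = P {ω | s < ‖Y ω‖}) :
    ∫⁻ ω, ENNReal.ofReal (σ (U ω)) * ENNReal.ofReal (W ω) ^ p ∂P ≤ sigmaPow P σ p Y := by
  have hm : AEMeasurable (fun ω => ‖Y ω‖ ^ p) P := hY.norm.aemeasurable.pow_const p
  obtain ⟨V, hV, hVY⟩ := exists_uniform_coMono hrich hm
  rw [hσ.sigmaPow_eq hV hp.le hY hVY]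
  simp only [coe_nnnorm_rpow _ hp.le]
  have h1 : ∫⁻ ω, ENNReal.ofReal (σ (U ω)) * ENNReal.ofReal (W ω) ^ p ∂P =
      ∫⁻ ω, ENNReal.ofReal (σ (U ω)) * ENNReal.ofReal (W ω ^ p) ∂P := by
    refine lintegral_congr_ae ?_
    filter_upwards [hW0] with ω hω
    rw [ENNReal.ofReal_rpow_of_nonneg hω hp.le]
  rw [h1]
  refine hσ.lintegral_mul_le hU hV (hW.pow_const p) ?_ hm
    (ae_of_all _ fun ω => Real.rpow_nonneg (norm_nonneg _) p) hVY fun s hs => ?_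
  · filter_upwards [hW0] with ω hω using Real.rpow_nonneg hω p
  · have h2 : {ω | s < W ω ^ p} =ᵐ[P] {ω | s ^ p⁻¹ < W ω} := by
      filter_upwards [hW0] with ω hω
      exact propext (Real.rpow_inv_lt_iff_of_pos hs hω hp).symm
    have h3 : {ω | s < ‖Y ω‖ ^ p} = {ω | s ^ p⁻¹ < ‖Y ω‖} := by
      ext ω
      exact (Real.rpow_inv_lt_iff_of_pos hs (norm_nonneg _) hp).symm
    rw [measure_congr h2, h3, hlaw]

theorem SigmaDominates.lintegral_mul_le [IsProbabilityMeasure P]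
    (hrich : ∃ U : Ω → ℝ, IsUniformRV P U) (hσ : IsDistortion σ) (hpq : p.HolderConjugate q)
    {𝕂 : Type*} [RCLike 𝕂] {Z Z' Y : Ω → 𝕂} (hZ : AEStronglyMeasurable Z P)
    (hZ' : AEStronglyMeasurable Z' P) (hY : AEStronglyMeasurable Y P)
    (h : SigmaDominates P σ Z' Z) :
    ∫⁻ ω, ‖Z ω‖ₑ * ‖Y ω‖ₑ ∂P ≤ sigmaNorm P σ q Z' * sigmaNorm P σ p Y := by
  obtain ⟨U, hU, hdom⟩ := h
  have hσU : AEMeasurable (fun ω => σ (U ω)) P := hU.aemeasurable_comp hσ.monotoneOn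
  have hk : AEMeasurable (fun ω => σ (U ω) * ‖Z' ω‖) P := hσU.mul hZ'.norm.aemeasurable
  have hk0 : ∀ᵐ ω ∂P, 0 ≤ σ (U ω) * ‖Z' ω‖ := by
    filter_upwards [hσ.ae_nonneg hU] with ω hω using mul_nonneg hω (norm_nonneg _)
  obtain ⟨V, hV, hVk⟩ := exists_uniform_coMono hrich hk
  have hYm : AEMeasurable (fun ω => ‖Y ω‖) P := hY.norm.aemeasurable
  set W : Ω → ℝ := fun ω => quantileFn P (fun ω => ‖Y ω‖) (V ω) with hWdef
  have hW : AEMeasurable W P := hV.aemeasurable_comp (monotoneOn_quantileFn hYm)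
  have hW0 : ∀ᵐ ω ∂P, 0 ≤ W ω := by
    filter_upwards [hV.ae_mem] with ω hω
    exact quantileFn_nonneg hYm (ae_of_all _ fun ω => norm_nonneg _) hω
  have hlaw : ∀ s, P {ω | s < W ω} = P {ω | s < ‖Y ω‖} := hV.measure_lt_quantileFn hYm
  have h1 : ∫⁻ ω, ‖Z ω‖ₑ * ‖Y ω‖ₑ ∂P ≤
      ∫⁻ ω, ENNReal.ofReal (σ (U ω) * ‖Z' ω‖) * ENNReal.ofReal (W ω) ∂P := by
    simp only [← ofReal_norm]
    exact lintegral_mul_le_of_tailInt_le hV hZ.norm.aemeasurable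
      (ae_of_all _ fun ω => norm_nonneg _) hk hk0 hYm (ae_of_all _ fun ω => norm_nonneg _) hW hW0
      hVk (coMono_comp_of_monotoneOn hV (monotoneOn_quantileFn hYm))
      (fun α hα => (avar_le_avar_iff hZ.norm.aemeasurable (ae_of_all _ fun ω => norm_nonneg _)
        hk hk0 hα).1 (hdom α hα)) fun s _ => (hlaw s).symm
  set Q : Measure Ω := P.withDensity fun ω => ENNReal.ofReal (σ (U ω)) with hQ
  have hQP : Q ≪ P := withDensity_absolutelyContinuous _ _
  have hQint : ∀ f : Ω → ℝ≥0∞, AEMeasurable f P →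
      ∫⁻ ω, f ω ∂Q = ∫⁻ ω, ENNReal.ofReal (σ (U ω)) * f ω ∂P := fun f hf =>
    lintegral_withDensity_eq_lintegral_mul₀ hσU.ennreal_ofReal hf
  have hZe : AEMeasurable (fun ω => (‖Z' ω‖₊ : ℝ≥0∞)) P := hZ'.enorm
  have h2 : ∫⁻ ω, ENNReal.ofReal (σ (U ω) * ‖Z' ω‖) * ENNReal.ofReal (W ω) ∂P =
      ∫⁻ ω, (‖Z' ω‖₊ : ℝ≥0∞) * ENNReal.ofReal (W ω) ∂Q := by
    refine Eq.trans (lintegral_congr_ae ?_) (hQint _ (hZe.mul hW.ennreal_ofReal)).symm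
    filter_upwards [hσ.ae_nonneg hU] with ω hω
    rw [ENNReal.ofReal_mul hω, ofReal_norm, mul_assoc]
    rfl
  refine h1.trans (h2.trans_le ((ENNReal.lintegral_mul_le_Lp_mul_Lq Q hpq.symm
    (hZe.mono_ac hQP) (hW.ennreal_ofReal.mono_ac hQP)).trans ?_))
  rw [hQint _ (hZe.pow_const q), hQint _ (hW.ennreal_ofReal.pow_const p)]
  refine mul_le_mul' (ENNReal.rpow_le_rpow ?_ (by simpa using hpq.symm.nonneg))
    (ENNReal.rpow_le_rpow ?_ (by simpa using hpq.nonneg))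
  · exact le_iSup₂_of_le U hU le_rfl
  · exact hσ.lintegral_rpow_le_sigmaPow hrich hU hpq.pos hY hW hW0 hlaw

end Holder

/-! ### Boundedness of functionals in the Köthe dual -/

section Bounded

variable {P : Measure Ω} {σ : ℝ → ℝ} {p : ℝ}

theorem IsDistortion.ae_lt_top [IsProbabilityMeasure P]
    (hrich : ∃ U : Ω → ℝ, IsUniformRV P U) (hσ : IsDistortion σ) {R : Ω → ℝ≥0∞}
    (hR : AEMeasurable R P)
    (hfin : ∀ U, IsUniformRV P U → ∫⁻ ω, ENNReal.ofReal (σ (U ω)) * R ω ∂P ≠ ∞) :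
    ∀ᵐ ω ∂P, R ω < ∞ := by
  have hg : AEMeasurable (fun ω => if R ω = ∞ then (1 : ℝ) else 0) P :=
    (Measurable.ite (measurableSet_singleton (∞ : ℝ≥0∞)) measurable_const
      measurable_const : Measurable fun r : ℝ≥0∞ => if r = ∞ then (1 : ℝ) else 0).comp_aemeasurable
      hR
  obtain ⟨V, hV, hVg⟩ := exists_uniform_coMono hrich hg
  obtain ⟨c, hc, hcV⟩ := hVg 0 le_rfl
  have hσV : AEMeasurable (fun ω => ENNReal.ofReal (σ (V ω))) P :=
    (hV.aemeasurable_comp hσ.monotoneOn).ennreal_ofReal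
  have hae := ae_lt_top' (hσV.mul hR) (hfin V hV)
  rcases hc.2.lt_or_eq with hc1 | rfl
  · refine absurd ?_ (hσ.setLIntegral_ne_zero hV ⟨hc.1, hc1⟩)
    rw [lintegral_eq_zero_iff' hσV.restrict]
    refine (ae_restrict_iff' (measurableSet_lt measurable_const hV.1)).2 ?_
    filter_upwards [hae, hcV] with ω h1 h2 h3
    have h4 : 0 < if R ω = ∞ then (1 : ℝ) else 0 := h2.symm.mp h3
    have h5 : R ω = ∞ := by
      by_contra h
      simp [h] at h4
    by_contra h
    simp only [Pi.mul_apply, h5] at h1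
    rw [ENNReal.mul_top h] at h1
    exact lt_irrefl _ h1
  · have h1 : ∀ᵐ ω ∂P, V ω < 1 := by
      filter_upwards [hV.ae_mem] with ω h using h.2
    filter_upwards [h1, hcV] with ω h2 h3
    refine lt_top_iff_ne_top.2 fun h => ?_
    have h4 : 0 < if R ω = ∞ then (1 : ℝ) else 0 := by simp [h]
    have h5 : 1 < V ω := h3.mp h4
    exact absurd h2 h5.le.not_gt

theorem enorm_ofReal_toReal {𝕂 : Type*} [RCLike 𝕂] {a : ℝ≥0∞} (ha : a ≠ ∞) :
    ‖((a.toReal : ℝ) : 𝕂)‖ₑ = a := by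
  rw [← ofReal_norm, RCLike.norm_ofReal, abs_of_nonneg ENNReal.toReal_nonneg,
    ENNReal.ofReal_toReal ha]

theorem KoetheDual.exists_bound [IsProbabilityMeasure P]
    (hrich : ∃ U : Ω → ℝ, IsUniformRV P U) (hσ : IsDistortion σ) (hp : 1 ≤ p)
    {𝕂 : Type*} [RCLike 𝕂] {Z : Ω → 𝕂} (hZ : KoetheDual P σ p Z) :
    ∃ C : ℝ≥0∞, C ≠ ∞ ∧ ∀ Y : Ω → 𝕂, AEStronglyMeasurable Y P → sigmaPow P σ p Y ≤ 1 →
      ∫⁻ ω, ‖Z ω‖ₑ * ‖Y ω‖ₑ ∂P ≤ C := by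
  by_contra! hcon
  have hp0 : 0 < p := zero_lt_one.trans_le hp
  choose Y hYm hY1 hYC using fun n : ℕ => hcon (4 ^ n) (by finiteness)
  set w : ℕ → ℝ≥0∞ := fun n => 2⁻¹ ^ n with hw
  have hw1 : ∀ n, w n ≤ 1 := fun n => pow_le_one₀ zero_le (by simp)
  have hwsum : ∑' n, w n ≠ ∞ := by
    rw [hw, ENNReal.tsum_geometric, ENNReal.one_sub_inv_two, inv_inv]
    finiteness
  set R : Ω → ℝ≥0∞ := fun ω => ⨆ n, w n * ‖Y n ω‖ₑ with hR
  have hRm : AEMeasurable R P := AEMeasurable.iSup fun n => (hYm n).enorm.const_mul _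
  have hRp : ∀ ω, R ω ^ p ≤ ∑' n, w n * ‖Y n ω‖ₑ ^ p := by
    intro ω
    rw [← ENNReal.le_rpow_inv_iff hp0]
    refine iSup_le fun n => ?_
    rw [ENNReal.le_rpow_inv_iff hp0, ENNReal.mul_rpow_of_nonneg _ _ hp0.le]
    refine le_trans ?_ (ENNReal.le_tsum n)
    gcongr
    exact ENNReal.rpow_le_self_of_le_one (hw1 n) hp
  have hfin : ∀ U, IsUniformRV P U →
      ∫⁻ ω, ENNReal.ofReal (σ (U ω)) * R ω ^ p ∂P ≤ ∑' n, w n := by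
    intro U hU
    have hσU : AEMeasurable (fun ω => ENNReal.ofReal (σ (U ω))) P :=
      (hU.aemeasurable_comp hσ.monotoneOn).ennreal_ofReal
    calc ∫⁻ ω, ENNReal.ofReal (σ (U ω)) * R ω ^ p ∂P
        ≤ ∫⁻ ω, ∑' n, w n * (ENNReal.ofReal (σ (U ω)) * ‖Y n ω‖ₑ ^ p) ∂P := by
          refine lintegral_mono fun ω => ?_
          refine (mul_le_mul_right (hRp ω) _).trans ?_
          rw [← ENNReal.tsum_mul_left]
          exact (tsum_congr fun n => mul_left_comm _ _ _).le
      _ = ∑' n, w n * ∫⁻ ω, ENNReal.ofReal (σ (U ω)) * ‖Y n ω‖ₑ ^ p ∂P := by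
          refine (lintegral_tsum fun n =>
            (hσU.mul ((hYm n).enorm.pow_const p)).const_mul (w n)).trans ?_
          exact tsum_congr fun n => lintegral_const_mul'' _ (hσU.mul ((hYm n).enorm.pow_const p))
      _ ≤ ∑' n, w n := by
          refine ENNReal.tsum_le_tsum fun n => ?_
          refine (mul_le_mul_right ((le_iSup₂_of_le U hU le_rfl).trans (hY1 n)) _).trans ?_
          rw [mul_one]
  have hRfin : ∀ᵐ ω ∂P, R ω < ∞ := by
    filter_upwards [hσ.ae_lt_top hrich (hRm.pow_const p) fun U hU =>
      ne_top_of_le_ne_top hwsum (hfin U hU)] with ω hω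
    refine lt_top_iff_ne_top.2 fun h => ?_
    rw [h, ENNReal.top_rpow_of_pos hp0] at hω
    exact lt_irrefl _ hω
  set X : Ω → 𝕂 := fun ω => ((R ω).toReal : 𝕂) with hX
  have hXm : AEStronglyMeasurable X P :=
    (RCLike.measurable_ofReal.comp_aemeasurable hRm.ennreal_toReal).aestronglyMeasurable
  have hXR : ∀ᵐ ω ∂P, ‖X ω‖ₑ = R ω := by
    filter_upwards [hRfin] with ω hω
    exact enorm_ofReal_toReal hω.ne
  have hXmem : MemLsigma P σ p X := by
    refine ⟨hXm, lt_of_le_of_lt (iSup₂_le fun U hU => ?_) hwsum.lt_top⟩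
    refine le_trans (lintegral_congr_ae ?_).le (hfin U hU)
    filter_upwards [hXR] with ω hω
    rw [← hω]
    rfl
  have hint : ∫⁻ ω, ‖Z ω * X ω‖ₑ ∂P < ∞ := (hZ.2 X hXmem).2
  have hge : ∀ n : ℕ, (2 : ℝ≥0∞) ^ n ≤ ∫⁻ ω, ‖Z ω * X ω‖ₑ ∂P := by
    intro n
    calc (2 : ℝ≥0∞) ^ n = w n * 4 ^ n := by
          rw [hw, ← mul_pow]
          congr 1
          rw [show (4 : ℝ≥0∞) = 2 * 2 by norm_num, ← mul_assoc,
            ENNReal.inv_mul_cancel (by simp) (by simp), one_mul]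
      _ ≤ w n * ∫⁻ ω, ‖Z ω‖ₑ * ‖Y n ω‖ₑ ∂P := mul_le_mul_right (hYC n).le _
      _ = ∫⁻ ω, w n * (‖Z ω‖ₑ * ‖Y n ω‖ₑ) ∂P :=
          (lintegral_const_mul'' _ (hZ.1.enorm.mul (hYm n).enorm)).symm
      _ ≤ ∫⁻ ω, ‖Z ω * X ω‖ₑ ∂P := by
          refine lintegral_mono_ae ?_
          filter_upwards [hXR] with ω hω
          rw [enorm_mul, hω, mul_left_comm]
          exact mul_le_mul_right (le_iSup (fun n => w n * ‖Y n ω‖ₑ) n) _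
  have h2 : Tendsto (fun n : ℕ => (2 : ℝ≥0∞) ^ n) atTop (𝓝 ∞) :=
    ENNReal.tendsto_pow_atTop_nhds_top_iff.2 (by norm_num)
  exact hint.not_ge (le_of_tendsto' h2 hge)

end Bounded

/-! ### The optimal dominating variable -/

section Optimal

variable {P : Measure Ω} {σ : ℝ → ℝ} {p q : ℝ}

theorem setLIntegral_map_withDensity {V : Ω → ℝ} (hV : Measurable V) {D : Ω → ℝ≥0∞}
    (hD : AEMeasurable D P) {f : ℝ → ℝ≥0∞} (hf : Measurable f) {s : Set ℝ}
    (hs : MeasurableSet s) :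
    ∫⁻ u in s, f u ∂((P.withDensity D).map V) = ∫⁻ ω in V ⁻¹' s, D ω * f (V ω) ∂P := by
  rw [setLIntegral_map hs hf hV, restrict_withDensity (hV hs)]
  exact lintegral_withDensity_eq_lintegral_mul₀ hD.restrict (hf.comp hV).aemeasurable

theorem lintegral_map_withDensity {V : Ω → ℝ} (hV : Measurable V) {D : Ω → ℝ≥0∞}
    (hD : AEMeasurable D P) {f : ℝ → ℝ≥0∞} (hf : Measurable f) :
    ∫⁻ u, f u ∂((P.withDensity D).map V) = ∫⁻ ω, D ω * f (V ω) ∂P := by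
  have := setLIntegral_map_withDensity hV hD hf MeasurableSet.univ
  rwa [preimage_univ, Measure.restrict_univ, Measure.restrict_univ] at this

theorem map_withDensity_eq_zero {V : Ω → ℝ} (hV : Measurable V) (D : Ω → ℝ≥0∞) {s : Set ℝ}
    (hs : MeasurableSet s) (h : P (V ⁻¹' s) = 0) : (P.withDensity D).map V s = 0 := by
  rw [Measure.map_apply hV hs]
  exact withDensity_absolutelyContinuous _ _ h

theorem IsUniformRV.nullSingletonClass_map [IsProbabilityMeasure P] {V : Ω → ℝ}
    (hV : IsUniformRV P V) (D : Ω → ℝ≥0∞) : NullSingletonClass ((P.withDensity D).map V) :=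
  ⟨fun x => map_withDensity_eq_zero hV.1 D (measurableSet_singleton x) (hV.measure_eq x)⟩

theorem exists_sigmaDominates_comp [IsProbabilityMeasure P]
    (hrich : ∃ U : Ω → ℝ, IsUniformRV P U) (hσ : IsDistortion σ)
    {𝕂 : Type*} [RCLike 𝕂] {Z : Ω → 𝕂} (hZ : AEStronglyMeasurable Z P)
    (hZfin : ∫⁻ ω, ‖Z ω‖ₑ ∂P ≠ ∞) :
    ∃ (V : Ω → ℝ) (x : ℝ → ℝ), IsUniformRV P V ∧ Measurable x ∧ (∀ u, 0 ≤ x u) ∧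
      MonotoneOn x (Ioo 0 1) ∧ SigmaDominates P σ (fun ω => (x (V ω) : 𝕂)) Z ∧
      ∀ φ : ℝ → ℝ≥0∞, Measurable φ →
        ∫⁻ ω, ‖Z ω‖ₑ * (∫⁻ l in Ioo 0 (x (V ω)), φ l) ∂P =
          ∫⁻ ω, ENNReal.ofReal (σ (V ω)) *
            (ENNReal.ofReal (x (V ω)) * ∫⁻ l in Ioo 0 (x (V ω)), φ l) ∂P := by
  obtain ⟨V, hV, hVZ⟩ := exists_uniform_coMono hrich hZ.norm.aemeasurable
  have hσV : AEMeasurable (fun ω => σ (V ω)) P := hV.aemeasurable_comp hσ.monotoneOn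
  have hVIci : P (V ⁻¹' Ici 1) = 0 := by
    refine measure_mono_null ?_ (ae_iff.1 hV.ae_mem)
    exact fun ω hω h => h.2.not_ge hω
  set ν : Measure ℝ := (P.withDensity fun ω => ‖Z ω‖ₑ).map V with hν
  set κ : Measure ℝ := (P.withDensity fun ω => ENNReal.ofReal (σ (V ω))).map V with hκ
  have := isFiniteMeasure_withDensity hZfin
  have := isFiniteMeasure_withDensity (μ := P) (f := fun ω => ENNReal.ofReal (σ (V ω)))
    (by rw [hσ.lintegral_comp hV]; exact ENNReal.one_ne_top)
  have : NullSingletonClass ν := hV.nullSingletonClass_map _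
  have : NullSingletonClass κ := hV.nullSingletonClass_map _
  have hνIoi : ∀ α, ν (Ioi α) = ∫⁻ ω in {ω | α < V ω}, ‖Z ω‖ₑ ∂P := by
    intro α
    have := setLIntegral_map_withDensity hV.1 hZ.enorm (measurable_const (a := (1 : ℝ≥0∞)))
      (measurableSet_Ioi (a := α))
    simp only [setLIntegral_one, mul_one] at this
    exact this
  have hκIoi : ∀ α, κ (Ioi α) = ∫⁻ ω in {ω | α < V ω}, ENNReal.ofReal (σ (V ω)) ∂P := by
    intro α
    have := setLIntegral_map_withDensity hV.1 hσV.ennreal_ofReal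
      (measurable_const (a := (1 : ℝ≥0∞))) (measurableSet_Ioi (a := α))
    simp only [setLIntegral_one, mul_one] at this
    exact this
  obtain ⟨x, hxm, hx0, hxmono, hxdom, hxφ⟩ := exists_level_function ν κ
    (map_withDensity_eq_zero hV.1 _ measurableSet_Ici hVIci)
    (map_withDensity_eq_zero hV.1 _ measurableSet_Ici hVIci)
    fun α hα => by
      rw [hκIoi]
      exact hσ.setLIntegral_ne_zero hV hα
  have hg : AEMeasurable (fun ω => σ (V ω) * ‖(x (V ω) : 𝕂)‖) P :=
    hσV.mul (RCLike.measurable_ofReal.comp (hxm.comp hV.1)).norm.aemeasurable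
  have hg0 : ∀ᵐ ω ∂P, 0 ≤ σ (V ω) * ‖(x (V ω) : 𝕂)‖ := by
    filter_upwards [hσ.ae_nonneg hV] with ω hω using mul_nonneg hω (norm_nonneg _)
  refine ⟨V, x, hV, hxm, hx0, hxmono.mono Ioo_subset_Iio_self, ⟨V, hV, fun α hα => ?_⟩,
    fun φ hφ => ?_⟩
  · rw [avar_le_avar_iff hZ.norm.aemeasurable (ae_of_all _ fun ω => norm_nonneg _) hg hg0 hα,
      ← setLIntegral_eq_tailInt hV hZ.norm.aemeasurable (ae_of_all _ fun ω => norm_nonneg _) hVZ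
        hα.1]
    simp only [ofReal_norm]
    rw [← hνIoi]
    refine (hxdom α hα).trans ?_
    refine le_trans (Eq.le ?_) (setLIntegral_le_tailInt hg hg0 (hV.measure_gt hα.1).le)
    rw [hκ, setLIntegral_map_withDensity hV.1 hσV.ennreal_ofReal hxm.ennreal_ofReal
      measurableSet_Ioi]
    refine setLIntegral_congr_fun_ae (measurableSet_lt measurable_const hV.1) ?_
    filter_upwards [hσ.ae_nonneg hV] with ω hω _
    rw [ENNReal.ofReal_mul hω, RCLike.norm_ofReal, abs_of_nonneg (hx0 _)]
  · have hmono : Monotone fun t : ℝ => ∫⁻ l in Ioo 0 t, φ l := fun s t hst =>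
      lintegral_mono_set (Ioo_subset_Ioo_right hst)
    have hm : Measurable fun u => ∫⁻ l in Ioo 0 (x u), φ l := hmono.measurable.comp hxm
    rw [← lintegral_map_withDensity hV.1 hZ.enorm hm]
    exact (hxφ φ hφ).trans
      (lintegral_map_withDensity hV.1 hσV.ennreal_ofReal (hxm.ennreal_ofReal.mul hm))

theorem lintegral_Ioo_rpow {r t : ℝ} (hr : 0 < r) (ht : 0 ≤ t) :
    ∫⁻ l in Ioo 0 t, ENNReal.ofReal (r * l ^ (r - 1)) = ENNReal.ofReal (t ^ r) := by
  have hint : IntervalIntegrable (fun l : ℝ => r * l ^ (r - 1)) volume 0 t :=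
    (intervalIntegral.intervalIntegrable_rpow' (by linarith)).const_mul r
  have h1 : ∫ l in (0 : ℝ)..t, r * l ^ (r - 1) = t ^ r := by
    rw [intervalIntegral.integral_const_mul, integral_rpow (Or.inl (by linarith)),
      sub_add_cancel, Real.zero_rpow hr.ne', sub_zero]
    field_simp
  rw [restrict_Ioo_eq_restrict_Ioc, ← h1, intervalIntegral.integral_of_le ht,
    ofReal_integral_eq_lintegral_ofReal ((intervalIntegrable_iff_integrableOn_Ioc_of_le ht).1 hint)]
  filter_upwards [ae_restrict_mem measurableSet_Ioc] with l hl
  exact mul_nonneg hr.le (Real.rpow_nonneg hl.1.le _)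

theorem sigmaPow_const_mul {𝕂 : Type*} [RCLike 𝕂] (hp : 0 ≤ p) (c : 𝕂) (Y : Ω → 𝕂) :
    sigmaPow P σ p (fun ω => c * Y ω) = ‖c‖ₑ ^ p * sigmaPow P σ p Y := by
  simp only [sigmaPow, ENNReal.mul_iSup]
  refine iSup_congr fun U => iSup_congr fun _ => ?_
  rw [← lintegral_const_mul' _ _ (ENNReal.rpow_ne_top_of_nonneg hp enorm_ne_top)]
  refine lintegral_congr fun ω => ?_
  rw [nnnorm_mul, ENNReal.coe_mul, ENNReal.mul_rpow_of_nonneg _ _ hp, mul_left_comm]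
  rfl

end Optimal

/-! ### Attainment of the dual norm -/

section Attained

variable {P : Measure Ω} {σ : ℝ → ℝ} {p q : ℝ}

theorem sigmaPow_one [IsProbabilityMeasure P] (hrich : ∃ U : Ω → ℝ, IsUniformRV P U)
    (hσ : IsDistortion σ) {𝕂 : Type*} [RCLike 𝕂] :
    sigmaPow P σ p (fun _ : Ω => (1 : 𝕂)) = 1 := by
  have h1 : ∀ U, IsUniformRV P U →
      ∫⁻ ω, ENNReal.ofReal (σ (U ω)) * (‖(1 : 𝕂)‖₊ : ℝ≥0∞) ^ p ∂P = 1 := by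
    intro U hU
    simpa using hσ.lintegral_comp hU
  obtain ⟨U, hU⟩ := hrich
  exact le_antisymm (iSup₂_le fun U hU => (h1 U hU).le) (le_iSup₂_of_le U hU (h1 U hU).ge)

theorem KoetheDual.exists_bound_mul [IsProbabilityMeasure P]
    (hrich : ∃ U : Ω → ℝ, IsUniformRV P U) (hσ : IsDistortion σ) (hp : 1 ≤ p)
    {𝕂 : Type*} [RCLike 𝕂] {Z : Ω → 𝕂} (hZ : KoetheDual P σ p Z) :
    ∃ C : ℝ≥0∞, C ≠ ∞ ∧ ∀ Y : Ω → 𝕂, AEStronglyMeasurable Y P → sigmaPow P σ p Y ≠ 0 →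
      sigmaPow P σ p Y ≠ ∞ → ∫⁻ ω, ‖Z ω‖ₑ * ‖Y ω‖ₑ ∂P ≤ C * sigmaNorm P σ p Y := by
  obtain ⟨C, hC, hbound⟩ := hZ.exists_bound hrich hσ hp
  have hp0 : 0 < p := zero_lt_one.trans_le hp
  refine ⟨C, hC, fun Y hY h0 htop => ?_⟩
  have hS0 : sigmaNorm P σ p Y ≠ 0 := by simp [sigmaNorm, h0, hp0.not_gt]
  have hStop : sigmaNorm P σ p Y ≠ ∞ := by simp [sigmaNorm, htop, hp0.le]
  have hSp : sigmaNorm P σ p Y ^ p = sigmaPow P σ p Y := by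
    rw [sigmaNorm, ← ENNReal.rpow_mul, one_div_mul_cancel hp0.ne', ENNReal.rpow_one]
  set S := sigmaNorm P σ p Y with hS
  set c : 𝕂 := ((S⁻¹.toReal : ℝ) : 𝕂) with hc
  have hcS : ‖c‖ₑ = S⁻¹ := enorm_ofReal_toReal (ENNReal.inv_ne_top.2 hS0)
  have h1 := hbound (fun ω => c * Y ω) (hY.const_mul c) (by
    rw [sigmaPow_const_mul hp0.le, hcS, ENNReal.inv_rpow, hSp, ENNReal.inv_mul_cancel h0 htop])
  have h2 : ∫⁻ ω, ‖Z ω‖ₑ * ‖c * Y ω‖ₑ ∂P = S⁻¹ * ∫⁻ ω, ‖Z ω‖ₑ * ‖Y ω‖ₑ ∂P := by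
    rw [← lintegral_const_mul' _ _ (ENNReal.inv_ne_top.2 hS0)]
    refine lintegral_congr fun ω => ?_
    rw [enorm_mul, hcS, mul_left_comm]
  rw [h2, mul_comm, ← div_eq_mul_inv] at h1
  exact (ENNReal.div_le_iff hS0 hStop).1 h1

theorem IsDistortion.sigmaPow_eq_of_norm_eq [IsProbabilityMeasure P] (hσ : IsDistortion σ)
    {V : Ω → ℝ} (hV : IsUniformRV P V) {y : ℝ → ℝ} (hy : MonotoneOn y (Ioo 0 1))
    (hy0 : ∀ u, 0 ≤ y u) {X : Type*} [NormedAddCommGroup X] {Y : Ω → X}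
    (hY : AEStronglyMeasurable Y P) {r m : ℝ} (hp : 0 ≤ p) (hm : 0 ≤ m) (hrm : r * p = m)
    (hYy : ∀ ω, ‖Y ω‖ = y (V ω) ^ r) :
    sigmaPow P σ p Y = ∫⁻ ω, ENNReal.ofReal (σ (V ω)) * ENNReal.ofReal (y (V ω) ^ m) ∂P := by
  have h1 : (fun ω => ‖Y ω‖ ^ p) = fun ω => y (V ω) ^ m := by
    funext ω
    rw [hYy, ← Real.rpow_mul (hy0 _), hrm]
  rw [hσ.sigmaPow_eq hV hp hY]
  · refine lintegral_congr fun ω => ?_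
    rw [coe_nnnorm_rpow _ hp, congrFun h1 ω]
  · rw [h1]
    exact coMono_comp_of_monotoneOn hV (f := fun u => y u ^ m) fun u hu v hv huv =>
      Real.rpow_le_rpow (hy0 u) (hy hu hv huv) hm

theorem le_rpow_of_le_mul_rpow {A C : ℝ≥0∞} (hpq : p.HolderConjugate q) (hA : A ≠ ∞)
    (h : A ≠ 0 → A ≤ C * A ^ (1 / p)) : A ≤ C ^ q := by
  rcases eq_or_ne A 0 with rfl | h0
  · exact zero_le
  have hq := hpq.symm.pos
  have h1 : A ^ q⁻¹ * A ^ (1 / p) = A := by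
    rw [← ENNReal.rpow_add _ _ h0 hA, one_div, add_comm, hpq.inv_add_inv_eq_one, ENNReal.rpow_one]
  rw [← ENNReal.rpow_inv_le_iff hq]
  refine (ENNReal.mul_le_mul_iff_left ?_ ?_).1 (h1.le.trans (h h0))
  · simp [h0, hA]
  · simp [hA, hpq.nonneg]

theorem KoetheDual.lintegral_ne_top [IsProbabilityMeasure P]
    (hrich : ∃ U : Ω → ℝ, IsUniformRV P U) (hσ : IsDistortion σ)
    {𝕂 : Type*} [RCLike 𝕂] {Z : Ω → 𝕂} (hZ : KoetheDual P σ p Z) : ∫⁻ ω, ‖Z ω‖ₑ ∂P ≠ ∞ := by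
  have h1 : Integrable (fun ω => Z ω * 1) P := hZ.2 (fun _ => 1)
    ⟨aestronglyMeasurable_const, by rw [sigmaPow_one hrich hσ]; exact ENNReal.one_lt_top⟩
  simp only [mul_one] at h1
  exact h1.2.ne

theorem lintegral_rpow_ne_top_of_level [IsProbabilityMeasure P]
    (hrich : ∃ U : Ω → ℝ, IsUniformRV P U) (hσ : IsDistortion σ) (hpq : p.HolderConjugate q)
    {𝕂 : Type*} [RCLike 𝕂] {Z : Ω → 𝕂} (hZ : KoetheDual P σ p Z) {V : Ω → ℝ}
    (hV : IsUniformRV P V) {x : ℝ → ℝ} (hxm : Measurable x) (hx0 : ∀ u, 0 ≤ x u)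
    (hx : MonotoneOn x (Ioo 0 1))
    (hφ : ∀ φ : ℝ → ℝ≥0∞, Measurable φ →
        ∫⁻ ω, ‖Z ω‖ₑ * (∫⁻ l in Ioo 0 (x (V ω)), φ l) ∂P =
          ∫⁻ ω, ENNReal.ofReal (σ (V ω)) *
            (ENNReal.ofReal (x (V ω)) * ∫⁻ l in Ioo 0 (x (V ω)), φ l) ∂P) :
    ∫⁻ ω, ENNReal.ofReal (σ (V ω)) * ENNReal.ofReal (x (V ω) ^ q) ∂P ≠ ∞ := by
  obtain ⟨C, hC, hbound⟩ := hZ.exists_bound_mul hrich hσ hpq.lt.le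
  have hq := hpq.symm.pos
  have hq1 : 0 < q - 1 := sub_pos.2 hpq.symm.lt
  have hσV : AEMeasurable (fun ω => ENNReal.ofReal (σ (V ω))) P :=
    (hV.aemeasurable_comp hσ.monotoneOn).ennreal_ofReal
  set y : ℕ → ℝ → ℝ := fun n u => min (x u) n with hy
  have hy0 : ∀ n u, 0 ≤ y n u := fun n u => le_min (hx0 u) n.cast_nonneg
  have hym : ∀ n, Measurable (y n) := fun n => hxm.min measurable_const
  have hymono : ∀ n, MonotoneOn (y n) (Ioo 0 1) := fun n u hu v hv huv =>
    min_le_min_right _ (hx hu hv huv)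
  set A : ℕ → ℝ≥0∞ := fun n =>
    ∫⁻ ω, ENNReal.ofReal (σ (V ω)) * ENNReal.ofReal (y n (V ω) ^ q) ∂P with hA
  have hAtop : ∀ n, A n ≠ ∞ := by
    intro n
    refine ne_top_of_le_ne_top (b := ENNReal.ofReal ((n : ℝ) ^ q)) ENNReal.ofReal_ne_top ?_
    calc A n ≤ ∫⁻ ω, ENNReal.ofReal (σ (V ω)) * ENNReal.ofReal ((n : ℝ) ^ q) ∂P := by
          refine lintegral_mono fun ω => mul_le_mul_right (ENNReal.ofReal_le_ofReal ?_) _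
          exact Real.rpow_le_rpow (hy0 n _) (min_le_right _ _) hq.le
      _ = ENNReal.ofReal ((n : ℝ) ^ q) := by
          rw [lintegral_mul_const'' _ hσV, hσ.lintegral_comp hV, one_mul]
  have hAle : ∀ n, A n ≤ ∫⁻ ω, ‖Z ω‖ₑ * ENNReal.ofReal (y n (V ω) ^ (q - 1)) ∂P := by
    intro n
    have hint : ∀ u, ∫⁻ l in Ioo 0 (x u),
        (Iio (n : ℝ)).indicator (fun l => ENNReal.ofReal ((q - 1) * l ^ (q - 1 - 1))) l =
          ENNReal.ofReal (y n u ^ (q - 1)) := by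
      intro u
      have hset : Iio (n : ℝ) ∩ Ioo 0 (x u) = Ioo 0 (y n u) := by
        ext l
        simp only [hy, mem_inter_iff, mem_Iio, mem_Ioo, lt_min_iff]
        tauto
      rw [setLIntegral_indicator measurableSet_Iio, hset, lintegral_Ioo_rpow hq1 (hy0 n u)]
    have h1 := hφ ((Iio (n : ℝ)).indicator fun l => ENNReal.ofReal ((q - 1) * l ^ (q - 1 - 1)))
      (Measurable.indicator (by fun_prop) measurableSet_Iio)
    simp only [hint] at h1
    rw [h1]
    refine lintegral_mono fun ω => mul_le_mul_right ?_ _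
    rw [← ENNReal.ofReal_mul (hx0 _)]
    refine ENNReal.ofReal_le_ofReal ?_
    have h2 : y n (V ω) ^ q = y n (V ω) * y n (V ω) ^ (q - 1) := by
      rw [← Real.rpow_one_add' (hy0 n _) (by linarith)]
      congr 1
      ring
    rw [h2]
    exact mul_le_mul_of_nonneg_right (min_le_left _ _) (Real.rpow_nonneg (hy0 n _) _)
  have hAC : ∀ n, A n ≤ C ^ q := by
    intro n
    set Y : Ω → 𝕂 := fun ω => ((y n (V ω) ^ (q - 1) : ℝ) : 𝕂) with hYdef
    have hY : AEStronglyMeasurable Y P :=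
      (RCLike.measurable_ofReal.comp (((hym n).comp hV.1).pow_const
        (q - 1))).aestronglyMeasurable
    have hYnorm : ∀ ω, ‖Y ω‖ = y n (V ω) ^ (q - 1) := fun ω => by
      rw [hYdef, RCLike.norm_ofReal, abs_of_nonneg (Real.rpow_nonneg (hy0 n _) _)]
    have hYA : sigmaPow P σ p Y = A n := hσ.sigmaPow_eq_of_norm_eq hV (hymono n) (hy0 n) hY
      hpq.nonneg hq.le hpq.symm.sub_one_mul_conj hYnorm
    refine le_rpow_of_le_mul_rpow hpq (hAtop n) fun h0 => (hAle n).trans ?_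
    have h1 := hbound Y hY (by rwa [hYA]) (by rw [hYA]; exact hAtop n)
    rw [sigmaNorm, hYA] at h1
    refine le_trans (lintegral_congr fun ω => ?_).le h1
    rw [← ofReal_norm (Y ω), hYnorm]
  refine ne_top_of_le_ne_top (ENNReal.rpow_ne_top_of_nonneg hq.le hC) (le_of_tendsto'
    (lintegral_tendsto_of_tendsto_of_monotone (fun n => hσV.mul
      ((((hym n).comp hV.1).pow_const q).ennreal_ofReal.aemeasurable)) (ae_of_all _ fun ω => ?_)
      (ae_of_all _ fun ω => ?_)) hAC)
  · intro n m hnm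
    refine mul_le_mul_right (ENNReal.ofReal_le_ofReal (Real.rpow_le_rpow (hy0 n _) ?_ hq.le)) _
    exact min_le_min_left _ (Nat.cast_le.2 hnm)
  · refine tendsto_const_nhds.congr' ?_
    filter_upwards [eventually_ge_atTop ⌈x (V ω)⌉₊] with n hn
    have h1 : y n (V ω) = x (V ω) := min_eq_left ((Nat.le_ceil _).trans (Nat.cast_le.2 hn))
    simp only [Pi.mul_apply, Function.comp_apply, h1]

theorem exists_measurable_mul_eq_norm {𝕂 : Type*} [RCLike 𝕂] :
    ∃ u : 𝕂 → 𝕂, Measurable u ∧ (∀ z, ‖u z‖ = 1) ∧ ∀ z, z * u z = (‖z‖ : 𝕂) := by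
  classical
  refine ⟨fun z => if z = 0 then 1 else (starRingEnd 𝕂) z / (‖z‖ : 𝕂), ?_, fun z => ?_,
    fun z => ?_⟩
  · refine Measurable.ite (measurableSet_singleton 0) measurable_const ?_
    exact RCLike.continuous_conj.measurable.div (RCLike.measurable_ofReal.comp measurable_norm)
  · by_cases hz : z = 0
    · simp [hz]
    · have : ‖z‖ ≠ 0 := norm_ne_zero_iff.2 hz
      simp [hz, this]
  · by_cases hz : z = 0
    · simp [hz]
    · have : (‖z‖ : 𝕂) ≠ 0 := by simpa using hz
      simp only [hz, if_false]
      rw [← mul_div_assoc, RCLike.mul_conj, sq, mul_div_cancel_right₀ _ this]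

theorem KoetheDual.exists_attaining [IsProbabilityMeasure P]
    (hrich : ∃ U : Ω → ℝ, IsUniformRV P U) (hσ : IsDistortion σ) (hpq : p.HolderConjugate q)
    {𝕂 : Type*} [RCLike 𝕂] {Z : Ω → 𝕂} (hZ : KoetheDual P σ p Z) :
    ∃ Z' Y : Ω → 𝕂, AEStronglyMeasurable Z' P ∧ SigmaDominates P σ Z' Z ∧
      sigmaNorm P σ q Z' ≠ ∞ ∧ MemLsigma P σ p Y ∧ sigmaNorm P σ p Y = 1 ∧
      ∫ ω, Z ω * Y ω ∂P = ((sigmaNorm P σ q Z').toReal : 𝕂) := by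
  obtain ⟨V, x, hV, hxm, hx0, hx, hdom, hφ⟩ :=
    exists_sigmaDominates_comp hrich hσ hZ.1 (hZ.lintegral_ne_top hrich hσ)
  have hp := hpq.pos
  have hq := hpq.symm.pos
  have hq1 : 0 < q - 1 := sub_pos.2 hpq.symm.lt
  set A := ∫⁻ ω, ENNReal.ofReal (σ (V ω)) * ENNReal.ofReal (x (V ω) ^ q) ∂P with hA
  have hAtop : A ≠ ∞ := lintegral_rpow_ne_top_of_level hrich hσ hpq hZ hV hxm hx0 hx hφ
  have hZA : ∫⁻ ω, ‖Z ω‖ₑ * ENNReal.ofReal (x (V ω) ^ (q - 1)) ∂P = A := by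
    have h1 := hφ (fun l => ENNReal.ofReal ((q - 1) * l ^ (q - 1 - 1))) (by fun_prop)
    simp only [lintegral_Ioo_rpow hq1 (hx0 _)] at h1
    rw [h1]
    refine lintegral_congr fun ω => ?_
    rw [← ENNReal.ofReal_mul (hx0 _), ← Real.rpow_one_add' (hx0 _) (by linarith)]
    ring_nf
  have hxV : Measurable fun ω => x (V ω) := hxm.comp hV.1
  set Z' : Ω → 𝕂 := fun ω => (x (V ω) : 𝕂) with hZ'
  have hZ'm : AEStronglyMeasurable Z' P :=
    (RCLike.measurable_ofReal.comp hxV).aestronglyMeasurable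
  have hZ'A : sigmaPow P σ q Z' = A := hσ.sigmaPow_eq_of_norm_eq hV hx hx0 hZ'm hq.le hq.le
    (one_mul q) fun ω => by
      rw [hZ', RCLike.norm_ofReal, abs_of_nonneg (hx0 _), Real.rpow_one]
  have hZ'norm : sigmaNorm P σ q Z' = A ^ (1 / q) := by rw [sigmaNorm, hZ'A]
  have hZ'top : sigmaNorm P σ q Z' ≠ ∞ := by
    rw [hZ'norm]
    exact ENNReal.rpow_ne_top_of_nonneg (one_div_nonneg.2 hq.le) hAtop
  rcases eq_or_ne A 0 with h0 | h0
  · have hnorm0 : sigmaNorm P σ q Z' = 0 := by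
      rw [hZ'norm, h0, ENNReal.zero_rpow_of_pos (one_div_pos.2 hq)]
    have h1 := hdom.lintegral_mul_le hrich hσ hpq hZ.1 hZ'm
      (aestronglyMeasurable_const (b := (1 : 𝕂)))
    rw [hnorm0, zero_mul] at h1
    simp only [enorm_one, mul_one] at h1
    have h2 : ∀ᵐ ω ∂P, Z ω = 0 := by
      filter_upwards [(lintegral_eq_zero_iff' hZ.1.enorm).1 (le_antisymm h1 zero_le)] with ω hω
      exact enorm_eq_zero.1 hω
    refine ⟨Z', fun _ => 1, hZ'm, hdom, hZ'top, ⟨aestronglyMeasurable_const, ?_⟩, ?_, ?_⟩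
    · rw [sigmaPow_one hrich hσ]
      exact ENNReal.one_lt_top
    · rw [sigmaNorm, sigmaPow_one hrich hσ, ENNReal.one_rpow]
    · rw [hnorm0, ENNReal.toReal_zero, RCLike.ofReal_zero]
      refine integral_eq_zero_of_ae ?_
      filter_upwards [h2] with ω hω
      simp [hω]
  · obtain ⟨u, hu, hu1, hzu⟩ := exists_measurable_mul_eq_norm (𝕂 := 𝕂)
    have hS0 : A ^ (1 / p) ≠ 0 := by simp [h0, hAtop]
    have hStop : A ^ (1 / p) ≠ ∞ := ENNReal.rpow_ne_top_of_nonneg (one_div_nonneg.2 hp.le) hAtop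
    set c : ℝ := ((A ^ (1 / p))⁻¹).toReal with hc
    have hcn : ‖(c : 𝕂)‖ₑ = (A ^ (1 / p))⁻¹ := enorm_ofReal_toReal (ENNReal.inv_ne_top.2 hS0)
    have hc0 : 0 ≤ c := ENNReal.toReal_nonneg
    set W : Ω → 𝕂 := fun ω => u (Z ω) * ((x (V ω) ^ (q - 1) : ℝ) : 𝕂) with hW
    have hWm : AEStronglyMeasurable W P :=
      ((hu.comp_aemeasurable hZ.1.aemeasurable).mul (RCLike.measurable_ofReal.comp
        (hxV.pow_const (q - 1))).aemeasurable).aestronglyMeasurable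
    have hWA : sigmaPow P σ p W = A := hσ.sigmaPow_eq_of_norm_eq hV hx hx0 hWm
      hp.le hq.le hpq.symm.sub_one_mul_conj fun ω => by
        rw [hW, norm_mul, hu1, one_mul, RCLike.norm_ofReal,
          abs_of_nonneg (Real.rpow_nonneg (hx0 _) _)]
    have hY1 : sigmaPow P σ p (fun ω => (c : 𝕂) * W ω) = 1 := by
      rw [sigmaPow_const_mul hp.le, hcn, hWA, ENNReal.inv_rpow, ← ENNReal.rpow_mul,
        one_div_mul_cancel hp.ne', ENNReal.rpow_one, ENNReal.inv_mul_cancel h0 hAtop]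
    refine ⟨Z', fun ω => (c : 𝕂) * W ω, hZ'm, hdom, hZ'top, ⟨hWm.const_mul _, ?_⟩, ?_, ?_⟩
    · rw [hY1]
      exact ENNReal.one_lt_top
    · rw [sigmaNorm, hY1, ENNReal.one_rpow]
    · have h1 : ∀ ω, Z ω * ((c : 𝕂) * W ω) =
          ((c * (‖Z ω‖ * x (V ω) ^ (q - 1)) : ℝ) : 𝕂) := by
        intro ω
        rw [hW, RCLike.ofReal_mul, RCLike.ofReal_mul, ← hzu]
        ring
      simp only [h1]
      rw [integral_ofReal, integral_const_mul, integral_eq_lintegral_of_nonneg_ae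
        (ae_of_all _ fun ω => mul_nonneg (norm_nonneg _) (Real.rpow_nonneg (hx0 _) _))
        (hZ.1.norm.mul (hxV.pow_const (q - 1)).aestronglyMeasurable)]
      have h2 : ∫⁻ ω, ENNReal.ofReal (‖Z ω‖ * x (V ω) ^ (q - 1)) ∂P = A := by
        rw [← hZA]
        refine lintegral_congr fun ω => ?_
        rw [ENNReal.ofReal_mul (norm_nonneg _), ofReal_norm]
      rw [h2, hc, ← ENNReal.toReal_mul, hZ'norm]
      congr 2
      have h3 : A ^ (1 / q) * A ^ (1 / p) = A := by
        rw [← ENNReal.rpow_add _ _ h0 hAtop, one_div, one_div, add_comm,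
          hpq.inv_add_inv_eq_one, ENNReal.rpow_one]
      rw [mul_comm, ← div_eq_mul_inv]
      nth_rewrite 1 [← h3]
      exact ENNReal.mul_div_cancel_right hS0 hStop

end Attained

end Auxiliary

/-- For `p ∈ (1,∞)` with conjugate exponent `q`:
`L_σ^p(P)^× = L*_{σ,q}(P)`; for `Z ∈ L_σ^p(P)^×` the functional `φ_Z(Y) = E(ZY)`
satisfies `|Z|*_{σ,q} = ‖φ_Z‖* = sup{|E(ZY)| : ‖Y‖_{σ,p} ≤ 1}`, and this supremum is
attained at some `Y` with `‖Y‖_{σ,p} = 1`. -/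
theorem statement15
    (P : Measure Ω) [IsProbabilityMeasure P]
    (hrich : ∃ U : Ω → ℝ, IsUniformRV P U)
    {𝕂 : Type*} [RCLike 𝕂]
    (σ : ℝ → ℝ) (hσ : IsDistortion σ)
    (p q : ℝ) (hp : 1 < p) (hq : 1 / p + 1 / q = 1) :
    (∀ Z : Ω → 𝕂, AEStronglyMeasurable Z P →
      (KoetheDual P σ p Z ↔ dualNormQ P σ q Z < ∞)) ∧
    (∀ Z : Ω → 𝕂, KoetheDual P σ p Z →
      (dualNormQ P σ q Z
        = ⨆ (Y : Ω → 𝕂) (_ : MemLsigma P σ p Y ∧ sigmaNorm P σ p Y ≤ 1),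
            ENNReal.ofReal ‖∫ ω, Z ω * Y ω ∂P‖) ∧
      (∃ Y : Ω → 𝕂, MemLsigma P σ p Y ∧ sigmaNorm P σ p Y = 1 ∧
        (∫ ω, Z ω * Y ω ∂P) = ((dualNormQ P σ q Z).toReal : 𝕂))) := by
  have hpq : p.HolderConjugate q :=
    Real.holderConjugate_iff.2 ⟨hp, by simpa only [one_div] using hq⟩
  have hbound : ∀ Z Y : Ω → 𝕂, AEStronglyMeasurable Z P → AEStronglyMeasurable Y P →
      sigmaNorm P σ p Y ≤ 1 → ∫⁻ ω, ‖Z ω‖ₑ * ‖Y ω‖ₑ ∂P ≤ dualNormQ P σ q Z := by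
    intro Z Y hZ hY hY1
    refine le_iInf₂ fun Z' hZ' => (hZ'.2.lintegral_mul_le hrich hσ hpq hZ hZ'.1 hY).trans ?_
    exact (mul_le_mul_right hY1 _).trans (mul_one _).le
  have hint : ∀ Z Y : Ω → 𝕂, ENNReal.ofReal ‖∫ ω, Z ω * Y ω ∂P‖ ≤
      ∫⁻ ω, ‖Z ω‖ₑ * ‖Y ω‖ₑ ∂P := by
    intro Z Y
    rw [ofReal_norm]
    refine (enorm_integral_le_lintegral_enorm _).trans (lintegral_congr fun ω => ?_).le
    exact enorm_mul _ _
  refine ⟨fun Z hZ => ⟨fun hK => ?_, fun hfin => ⟨hZ, fun Y hY => ?_⟩⟩, fun Z hK => ?_⟩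
  · obtain ⟨Z', Y, hZ', hdom, htop, -⟩ := hK.exists_attaining hrich hσ hpq
    exact (iInf₂_le Z' ⟨hZ', hdom⟩).trans_lt htop.lt_top
  · obtain ⟨Z', hZ'⟩ := iInf_lt_iff.1 hfin
    obtain ⟨⟨hZ'm, hdom⟩, htop⟩ := iInf_lt_iff.1 hZ'
    refine ⟨hZ.mul hY.1, ?_⟩
    have h1 := hdom.lintegral_mul_le hrich hσ hpq hZ hZ'm hY.1
    have h2 : sigmaNorm P σ p Y < ∞ := ENNReal.rpow_lt_top_of_nonneg (by simpa using hpq.nonneg)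
      hY.2.ne
    have h3 : ∫⁻ ω, ‖Z ω * Y ω‖ₑ ∂P < ∞ := by
      simp only [enorm_mul]
      exact h1.trans_lt (ENNReal.mul_lt_top htop h2)
    exact h3
  · obtain ⟨Z', Y, hZ', hdom, htop, hY, hY1, hZY⟩ := hK.exists_attaining hrich hσ hpq
    have hle : dualNormQ P σ q Z ≤ sigmaNorm P σ q Z' := iInf₂_le Z' ⟨hZ', hdom⟩
    have hval : ENNReal.ofReal ‖∫ ω, Z ω * Y ω ∂P‖ = sigmaNorm P σ q Z' := by
      rw [hZY, ofReal_norm, enorm_ofReal_toReal htop]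
    have heq : dualNormQ P σ q Z = sigmaNorm P σ q Z' :=
      le_antisymm hle (hval.symm.le.trans ((hint Z Y).trans (hbound Z Y hK.1 hY.1 hY1.le)))
    refine ⟨le_antisymm ?_ ?_, Y, hY, hY1, ?_⟩
    · rw [heq, ← hval]
      exact le_iSup₂_of_le Y ⟨hY, hY1.le⟩ le_rfl
    · exact iSup₂_le fun X hX => (hint Z X).trans (hbound Z X hK.1 hX.1.1 hX.2)
    · rw [hZY, heq]

end
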